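/- arXiv:1508.04696 — 2 statements merged into one kernel-verified Lean document; each statement's English description precedes it below -/
import Mathlib

section
/- Suppose V : ℝ → ℝ is a continuous T-periodic potential, ε > 0, and Λ, R > 1. Then there exist T' > 0 (an integer multiple of T) and a finite set {W₁, …, W_ℓ} of continuous T'-periodic potentials with ‖W_j - V‖_∞ < ε for each j, such that for every λ ∈ [Λ^{-1}, Λ] one has [-R,R] ∩ ⋂_{j=1}^ℓ σ(H_{λ W_j}) = ∅; i.e., every energy in [-R,R] lies in the resolvent set of H_{λ W_j} for some j. -/
open MeasureTheory Filter Set BoundedContinuousFunction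
open scoped ENNReal

noncomputable section
/-- The spectrum of the Schrödinger operator `H_V φ = -φ'' + Vφ` on `L²(ℝ)`, characterized
via Weyl sequences drawn from the core `C_c²(ℝ)` of the (essentially self-adjoint) operator:
`E ∈ σ(H_V)` iff there are compactly supported `C²` functions `u` of unit `L²` norm with
`‖(H_V - E)u‖_{L²}` arbitrarily small. -/
def schrodingerSpectrum (V : ℝ → ℝ) : Set ℝ :=
  {E : ℝ | ∀ ε : ℝ, 0 < ε → ∃ u : ℝ → ℂ,
    ContDiff ℝ 2 u ∧ HasCompactSupport u ∧
    (∫ x : ℝ, ‖u x‖ ^ 2) = 1 ∧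
    (∫ x : ℝ, ‖-deriv (deriv u) x + (V x : ℂ) * u x - (E : ℂ) * u x‖ ^ 2) < ε}



lemma expint_aux {g : ℝ → ℝ × ℝ} {M K : ℝ} (hM : 0 ≤ M) (hK : 0 < K)
    (hb : ∀ s, ‖g s‖ ≤ M * Real.exp (K * |s|)) {t : ℝ} (ht : 0 ≤ t) :
    ‖∫ s in (0:ℝ)..t, g s‖ ≤ M / K * Real.exp (K * |t|) := by
  have h1 : ∀ x : ℝ, HasDerivAt (fun x => M / K * Real.exp (K * x)) (M * Real.exp (K * x)) x := by
    intro x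
    have := ((((hasDerivAt_id x).const_mul K).exp).const_mul (M / K))
    refine this.congr_deriv ?_
    simp; field_simp
  have hc : Continuous fun x => M * Real.exp (K * x) := by fun_prop
  have h2 : ‖∫ s in (0:ℝ)..t, g s‖ ≤ ∫ s in (0:ℝ)..t, M * Real.exp (K * s) := by
    apply intervalIntegral.norm_integral_le_of_norm_le ht
    · filter_upwards with s hs
      have := hb s
      rwa [abs_of_pos hs.1] at this
    · exact hc.intervalIntegrable _ _
  rw [intervalIntegral.integral_eq_sub_of_hasDerivAt (fun x _ => h1 x)
    (hc.intervalIntegrable _ _)] at h2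
  rw [abs_of_nonneg ht]
  have : 0 ≤ M / K := by positivity
  simp at h2
  linarith

lemma expint {g : ℝ → ℝ × ℝ} {M K : ℝ} (hM : 0 ≤ M) (hK : 0 < K)
    (hb : ∀ s, ‖g s‖ ≤ M * Real.exp (K * |s|)) (t : ℝ) :
    ‖∫ s in (0:ℝ)..t, g s‖ ≤ M / K * Real.exp (K * |t|) := by
  rcases le_total 0 t with ht | ht
  · exact expint_aux hM hK hb ht
  · have h := expint_aux (g := fun s => g (-s)) hM hK (fun s => by simpa using hb (-s))
      (t := -t) (by linarith)
    rw [intervalIntegral.integral_comp_neg, abs_neg, intervalIntegral.integral_symm, norm_neg] at h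
    simpa using h

def fld (q : ℝ → ℝ) (s : ℝ) (y : ℝ × ℝ) : ℝ × ℝ := (y.2, q s * y.1)

lemma fld_norm {q : ℝ → ℝ} {C : ℝ} (hC1 : 1 ≤ C) (hC : ∀ s, |q s| ≤ C) (s : ℝ) (y : ℝ × ℝ) :
    ‖fld q s y‖ ≤ C * ‖y‖ := by
  rw [fld, Prod.norm_def]
  have h1 : ‖y.1‖ ≤ ‖y‖ := norm_fst_le y
  have h2 : ‖y.2‖ ≤ ‖y‖ := norm_snd_le y
  apply max_le
  · nlinarith [norm_nonneg y]
  · simp only [norm_mul, Real.norm_eq_abs] at *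
    exact mul_le_mul (hC s) h1 (abs_nonneg _) (by linarith)

lemma fld_sub (q : ℝ → ℝ) (s : ℝ) (y z : ℝ × ℝ) : fld q s y - fld q s z = fld q s (y - z) := by
  ext <;> simp [fld]; ring

lemma fld_cont {q : ℝ → ℝ} (hq : Continuous q) {y : ℝ → ℝ × ℝ} (hy : Continuous y) :
    Continuous fun s => fld q s (y s) := by
  unfold fld; fun_prop

lemma ode_exists (q : ℝ → ℝ) (hq : Continuous q) (C : ℝ) (hC : ∀ s, |q s| ≤ C) (y0 : ℝ × ℝ) :
    ∃ y : ℝ → ℝ × ℝ, y 0 = y0 ∧ ∀ t, HasDerivAt y (fld q t (y t)) t := by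
  wlog hC1 : 1 ≤ C generalizing C
  · exact this 1 (fun s => (hC s).trans (by linarith)) le_rfl
  set K := 2 * C with hKdef
  have hK : 0 < K := by linarith
  let w : ℝ → ℝ := fun t => Real.exp (K * |t|)
  have hw : Continuous w := by fun_prop
  have hwpos : ∀ t, 0 < w t := fun t => Real.exp_pos _
  have hwi : Continuous fun t => (w t)⁻¹ := hw.inv₀ (fun t => (hwpos t).ne')
  have hw1 : ∀ t, 1 ≤ w t := fun t => Real.one_le_exp (by positivity)
  have hgc : ∀ z : ℝ →ᵇ ℝ × ℝ, Continuous fun s => fld q s (w s • z s) := fun z =>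
    fld_cont hq (hw.smul z.continuous)
  have hgb : ∀ z : ℝ →ᵇ ℝ × ℝ, ∀ s, ‖fld q s (w s • z s)‖ ≤ (C * ‖z‖) * w s := by
    intro z s
    refine (fld_norm hC1 hC s _).trans ?_
    rw [norm_smul, Real.norm_of_nonneg (hwpos s).le, mul_assoc, mul_comm (w s)]
    have := z.norm_coe_le_norm s
    have := hwpos s
    gcongr
  have hCK : C / K = 1 / 2 := by rw [hKdef]; field_simp
  have hI : ∀ z : ℝ →ᵇ ℝ × ℝ, ∀ t,
      ‖∫ s in (0:ℝ)..t, fld q s (w s • z s)‖ ≤ (1 / 2 * ‖z‖) * w t := by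
    intro z t
    refine (expint (by positivity) hK (hgb z) t).trans (le_of_eq ?_)
    rw [← hCK]; simp only [w]; ring
  let F : (ℝ →ᵇ ℝ × ℝ) → (ℝ →ᵇ ℝ × ℝ) := fun z =>
    BoundedContinuousFunction.ofNormedAddCommGroup
      (fun t => (w t)⁻¹ • (y0 + ∫ s in (0:ℝ)..t, fld q s (w s • z s)))
      (hwi.smul (continuous_const.add
        (intervalIntegral.continuous_primitive (fun a b => (hgc z).intervalIntegrable a b) 0)))
      (‖y0‖ + 1 / 2 * ‖z‖)
      (by
        intro t
        rw [norm_smul, norm_inv, Real.norm_of_nonneg (hwpos t).le, inv_mul_le_iff₀ (hwpos t)]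
        refine (norm_add_le _ _).trans ?_
        have := hI z t
        nlinarith [norm_nonneg y0, hw1 t])
  have hF : ContractingWith (1 / 2) F := by
    refine ⟨by norm_num, LipschitzWith.of_dist_le_mul fun z z' => ?_⟩
    rw [BoundedContinuousFunction.dist_le (by positivity)]
    intro t
    have h1 : F z t - F z' t = (w t)⁻¹ • ∫ s in (0:ℝ)..t, fld q s (w s • (z - z') s) := by
      have h3 : (∫ s in (0:ℝ)..t, fld q s (w s • (z - z') s)) =
          (∫ s in (0:ℝ)..t, fld q s (w s • z s)) - ∫ s in (0:ℝ)..t, fld q s (w s • z' s) := by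
        rw [← intervalIntegral.integral_sub ((hgc z).intervalIntegrable _ _)
          ((hgc z').intervalIntegrable _ _)]
        congr 1; ext1 s
        rw [fld_sub, ← smul_sub]; rfl
      rw [h3]
      show (w t)⁻¹ • (y0 + _) - (w t)⁻¹ • (y0 + _) = _
      rw [← smul_sub]; congr 1; abel
    rw [dist_eq_norm, h1, norm_smul, norm_inv, Real.norm_of_nonneg (hwpos t).le,
      inv_mul_le_iff₀ (hwpos t)]
    refine (hI (z - z') t).trans (le_of_eq ?_)
    rw [dist_eq_norm]; simp; ring
  obtain ⟨z, hz⟩ : ∃ z, F z = z := ⟨_, hF.fixedPoint_isFixedPt⟩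
  have hy : ∀ t, w t • z t = y0 + ∫ s in (0:ℝ)..t, fld q s (w s • z s) := by
    intro t
    have : F z t = z t := by rw [hz]
    rw [← this]
    show w t • (w t)⁻¹ • (y0 + ∫ s in (0:ℝ)..t, fld q s (w s • z s)) = _
    rw [smul_inv_smul₀ (hwpos t).ne']
  refine ⟨fun t => w t • z t, ?_, fun t => ?_⟩
  · refine (hy 0).trans ?_
    simp
  · have h := (intervalIntegral.integral_hasDerivAt_right ((hgc z).intervalIntegrable 0 t)
      (hgc z).aestronglyMeasurable.stronglyMeasurableAtFilter (hgc z).continuousAt).const_add y0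
    exact h.congr_of_eventuallyEq (Eventually.of_forall hy)

lemma ode_unique (q : ℝ → ℝ) (C : ℝ) (hC : ∀ s, |q s| ≤ C) {y z : ℝ → ℝ × ℝ}
    (hy : ∀ t, HasDerivAt y (fld q t (y t)) t) (hz : ∀ t, HasDerivAt z (fld q t (z t)) t)
    {t0 : ℝ} (h : y t0 = z t0) : y = z := by
  wlog hC1 : 1 ≤ C generalizing C
  · exact this 1 (fun s => (hC s).trans (by linarith)) le_rfl
  refine ODE_solution_unique_univ (K := ⟨C, by linarith⟩) (s := fun _ => univ) (v := fld q)
    (fun t => ?_) (fun t => ⟨hy t, mem_univ _⟩) (fun t => ⟨hz t, mem_univ _⟩) h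
  refine (LipschitzWith.of_dist_le_mul fun a b => ?_).lipschitzOnWith
  rw [dist_eq_norm, dist_eq_norm, fld_sub]
  exact fld_norm hC1 hC t _


lemma cc_int {f : ℝ → ℝ} (hf : Continuous f) (h : HasCompactSupport f) : Integrable f :=
  hf.integrable_of_hasCompactSupport h

lemma scalar_bd (γ : ℝ) (z z' : ℝ → ℝ) (hz : ∀ x, HasDerivAt z (z' x) x) (hc : Continuous z')
    (hs : HasCompactSupport z) :
    γ ^ 2 * ∫ x, z x ^ 2 ≤ ∫ x, (z' x - γ * z x) ^ 2 := by
  have hzc : Continuous z := continuous_iff_continuousAt.2 fun x => (hz x).continuousAt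
  have hz' : z' = deriv z := by ext x; exact (hz x).deriv.symm
  have hs' : HasCompactSupport z' := hz' ▸ hs.deriv
  have i1 : Integrable fun x => z x ^ 2 := cc_int (by fun_prop)
    (hs.comp_left (g := fun t => t ^ 2) (by simp))
  have i2 : Integrable fun x => z' x ^ 2 := cc_int (by fun_prop)
    (hs'.comp_left (g := fun t => t ^ 2) (by simp))
  have i3 : Integrable fun x => 2 * z x * z' x := cc_int (by fun_prop) (hs'.mul_left)
  have h0 : ∫ x, 2 * z x * z' x = 0 := by
    apply integral_eq_zero_of_hasDerivAt_of_integrable (f := fun x => z x ^ 2) _ i3 i1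
    intro x
    refine ((hz x).pow 2).congr_deriv ?_
    simp
  have : ∫ x, (z' x - γ * z x) ^ 2 =
      (∫ x, z' x ^ 2) - γ * (∫ x, 2 * z x * z' x) + γ ^ 2 * ∫ x, z x ^ 2 := by
    have i4 : Integrable fun x => z' x ^ 2 - γ * (2 * z x * z' x) := i2.sub (i3.const_mul _)
    rw [← integral_const_mul, ← integral_const_mul, ← integral_sub i2 (i3.const_mul _),
      ← integral_add i4 (i1.const_mul _)]
    congr 1; ext x; ring
  rw [this, h0]
  have : 0 ≤ ∫ x, z' x ^ 2 := integral_nonneg fun x => sq_nonneg _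
  linarith

lemma real_bd (W p D : ℝ → ℝ) (γ B c : ℝ) (hγ : γ ≠ 0) (hc : 0 < c)
    (hW : Continuous W) (hWb : ∀ x, |W x| ≤ B)
    (hp : ∀ x, HasDerivAt p (D x - γ * p x) x)
    (hD : ∀ x, HasDerivAt D (W x * p x - γ * D x) x)
    (hpb : ∀ x, |p x| ≤ B) (hDb : ∀ x, |D x| ≤ B)
    (hn : ∀ x, c ≤ p x ^ 2 + D x ^ 2) :
    ∃ C : ℝ, 0 < C ∧ ∀ u : ℝ → ℝ, ContDiff ℝ 2 u → HasCompactSupport u →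
      ∫ x, u x ^ 2 ≤ C * ∫ x, (- deriv (deriv u) x + W x * u x) ^ 2 := by
  have hB : 0 ≤ B := (abs_nonneg _).trans (hWb 0)
  have hpc : Continuous p := continuous_iff_continuousAt.2 fun x => (hp x).continuousAt
  have hDc : Continuous D := continuous_iff_continuousAt.2 fun x => (hD x).continuousAt
  have hn0 : ∀ x, p x ^ 2 + D x ^ 2 ≠ 0 := fun x => (hc.trans_le (hn x)).ne'
  have hp2 : ∀ x, p x ^ 2 ≤ B ^ 2 := fun x => sq_le_sq' (by linarith [abs_le.1 (hpb x)])
    (abs_le.1 (hpb x)).2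
  have hD2 : ∀ x, D x ^ 2 ≤ B ^ 2 := fun x => sq_le_sq' (by linarith [abs_le.1 (hDb x)])
    (abs_le.1 (hDb x)).2
  have hDn : ∀ x, (D x / (p x ^ 2 + D x ^ 2)) ^ 2 ≤ (B / c) ^ 2 := by
    intro x
    apply sq_le_sq.2
    rw [abs_div, abs_div, abs_of_nonneg hB, abs_of_pos hc, abs_of_pos (hc.trans_le (hn x))]
    exact div_le_div₀ hB (hDb x) hc (hn x)
  set κ : ℝ → ℝ := fun x => (1 + W x) * (p x ^ 2 - D x ^ 2) / (p x ^ 2 + D x ^ 2) ^ 2 with hκ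
  have hκc : Continuous κ := by
    apply Continuous.div (by fun_prop) (by fun_prop)
    intro x; exact pow_ne_zero _ (hn0 x)
  have hκb : ∀ x, κ x ^ 2 ≤ ((1 + B) * B ^ 2 / c ^ 2) ^ 2 := by
    intro x
    apply sq_le_sq.2
    have hcp : 0 < p x ^ 2 + D x ^ 2 := hc.trans_le (hn x)
    rw [hκ]
    simp only
    rw [abs_div, abs_div, abs_mul, abs_of_nonneg (show 0 ≤ (1 + B) * B ^ 2 by positivity),
      abs_of_pos (show 0 < c ^ 2 by positivity),
      abs_of_pos (show 0 < (p x ^ 2 + D x ^ 2) ^ 2 by positivity)]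
    apply div_le_div₀ (by positivity) _ (by positivity)
    · exact pow_le_pow_left₀ hc.le (hn x) 2
    · apply mul_le_mul _ _ (abs_nonneg _) (by positivity)
      · rw [abs_le]; have := abs_le.1 (hWb x); constructor <;> linarith
      · rw [abs_le]; constructor <;> nlinarith [hp2 x, hD2 x, sq_nonneg (p x), sq_nonneg (D x)]
  set k1 := ((1 + B) * B ^ 2 / c ^ 2) ^ 2
  set b1 := (B / c) ^ 2
  have hk1 : 0 ≤ k1 := sq_nonneg _
  have hb1 : 0 ≤ b1 := sq_nonneg _
  have hγ2 : 0 < γ ^ 2 := by positivity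
  set Cβ := B ^ 2 / γ ^ 2
  set Cα := (2 * k1 * Cβ + 2 * b1) / γ ^ 2
  have hCβ : 0 ≤ Cβ := by positivity
  have hCα : 0 ≤ Cα := by positivity
  refine ⟨2 * B ^ 2 * Cα + 2 * b1 * Cβ + 1, by positivity, fun u hu hus => ?_⟩
  set u' := deriv u with hu'
  set u'' := deriv u' with hu''
  have hu1 : ContDiff ℝ 1 u' := (contDiff_succ_iff_deriv.1 (by rw [one_add_one_eq_two]; exact hu : ContDiff ℝ (1 + 1) u)).2.2
  have hu2 : Continuous u'' := hu1.continuous_deriv le_rfl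
  have huc : Continuous u := hu.continuous
  have hu1c : Continuous u' := hu1.continuous
  have d1 : ∀ x, HasDerivAt u (u' x) x := fun x => (hu.differentiable (by norm_num) x).hasDerivAt
  have d2 : ∀ x, HasDerivAt u' (u'' x) x := fun x => (hu1.differentiable (by norm_num) x).hasDerivAt
  have s1 : HasCompactSupport u' := hus.deriv
  have s2 : HasCompactSupport u'' := s1.deriv
  set f : ℝ → ℝ := fun x => - u'' x + W x * u x with hf
  have hfc : Continuous f := by fun_prop
  have hfs : HasCompactSupport f := (s2.neg).add hus.mul_left
  set β : ℝ → ℝ := fun x => p x * u' x - D x * u x with hβ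
  have hβc : Continuous β := by fun_prop
  have hβs : HasCompactSupport β := (s1.mul_left).sub hus.mul_left
  set α : ℝ → ℝ := fun x => (p x * u x + D x * u' x) / (p x ^ 2 + D x ^ 2) with hα
  have hαc : Continuous α := by
    apply Continuous.div (by fun_prop) (by fun_prop) hn0
  have hαs : HasCompactSupport α := by
    have h : HasCompactSupport (fun x => (p x * u x + D x * u' x) * (p x ^ 2 + D x ^ 2)⁻¹) :=
      ((hus.mul_left).add s1.mul_left).mul_right
    simpa only [hα, div_eq_mul_inv] using h
  have sqi : ∀ {g : ℝ → ℝ}, Continuous g → HasCompactSupport g → Integrable fun x => g x ^ 2 :=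
    fun {g} h1 h2 => cc_int (by fun_prop) (h2.comp_left (g := fun t => t ^ 2) (by simp))
  have iu := sqi huc hus
  have iff' := sqi hfc hfs
  have iβ := sqi hβc hβs
  have iα := sqi hαc hαs
  have hDnc : Continuous fun x => D x / (p x ^ 2 + D x ^ 2) := hDc.div (by fun_prop) hn0
  have e1 : γ ^ 2 * ∫ x, β x ^ 2 ≤ B ^ 2 * ∫ x, f x ^ 2 := by
    have h := scalar_bd (-γ) β (fun x => -γ * β x - p x * f x) (fun x => by
      have := ((hp x).mul (d2 x)).sub ((hD x).mul (d1 x))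
      refine this.congr_deriv ?_
      simp only [hβ, hf]; ring) (by fun_prop) hβs
    rw [neg_sq] at h
    refine h.trans ?_
    rw [← integral_const_mul]
    apply integral_mono
    · have := sqi (g := fun x => -γ * β x - p x * f x - -γ * β x) (by fun_prop) (by
        have : HasCompactSupport fun x => - (p x) * f x := hfs.mul_left
        convert this using 2; ring)
      exact this
    · exact iff'.const_mul _
    · intro x
      show (-γ * β x - p x * f x - -γ * β x) ^ 2 ≤ B ^ 2 * f x ^ 2
      have := mul_le_mul_of_nonneg_right (hp2 x) (sq_nonneg (f x))
      nlinarith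
  have e2 : γ ^ 2 * ∫ x, α x ^ 2 ≤ 2 * k1 * (∫ x, β x ^ 2) + 2 * b1 * ∫ x, f x ^ 2 := by
    have h := scalar_bd γ α
      (fun x => γ * α x + (κ x * β x - D x / (p x ^ 2 + D x ^ 2) * f x)) (fun x => by
      have := (((hp x).mul (d1 x)).add ((hD x).mul (d2 x))).div
        (((hp x).pow 2).add ((hD x).pow 2)) (hn0 x)
      refine this.congr_deriv ?_
      have := hn0 x
      simp only [hα, hβ, hf, hκ]
      simp
      field_simp
      ring) (by fun_prop) hαs
    refine h.trans ?_
    rw [← integral_const_mul, ← integral_const_mul, ← integral_add (iβ.const_mul _) (iff'.const_mul _)]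
    apply integral_mono
    · have := sqi (g := fun x => γ * α x + (κ x * β x - D x / (p x ^ 2 + D x ^ 2) * f x) - γ * α x)
        (by fun_prop) (by
        have : HasCompactSupport fun x => κ x * β x - D x / (p x ^ 2 + D x ^ 2) * f x :=
          (hβs.mul_left).sub hfs.mul_left
        convert this using 2; ring)
      exact this
    · exact (iβ.const_mul _).add (iff'.const_mul _)
    · intro x
      show (γ * α x + (κ x * β x - D x / (p x ^ 2 + D x ^ 2) * f x) - γ * α x) ^ 2 ≤
        2 * k1 * β x ^ 2 + 2 * b1 * f x ^ 2
      have h1 := mul_le_mul_of_nonneg_right (hκb x) (sq_nonneg (β x))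
      have h2 := mul_le_mul_of_nonneg_right (hDn x) (sq_nonneg (f x))
      nlinarith [sq_nonneg (κ x * β x + D x / (p x ^ 2 + D x ^ 2) * f x)]
  have e3 : ∫ x, u x ^ 2 ≤ 2 * B ^ 2 * (∫ x, α x ^ 2) + 2 * b1 * ∫ x, β x ^ 2 := by
    rw [← integral_const_mul, ← integral_const_mul, ← integral_add (iα.const_mul _) (iβ.const_mul _)]
    apply integral_mono iu ((iα.const_mul _).add (iβ.const_mul _))
    intro x
    show u x ^ 2 ≤ 2 * B ^ 2 * α x ^ 2 + 2 * b1 * β x ^ 2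
    have h0 : u x = p x * α x - D x / (p x ^ 2 + D x ^ 2) * β x := by
      have := hn0 x
      simp only [hα, hβ]; field_simp; ring
    have h1 := mul_le_mul_of_nonneg_right (hp2 x) (sq_nonneg (α x))
    have h2 := mul_le_mul_of_nonneg_right (hDn x) (sq_nonneg (β x))
    rw [h0]
    nlinarith [sq_nonneg (p x * α x + D x / (p x ^ 2 + D x ^ 2) * β x)]
  have hI : 0 ≤ ∫ x, f x ^ 2 := integral_nonneg fun x => sq_nonneg _
  have e1' : ∫ x, β x ^ 2 ≤ Cβ * ∫ x, f x ^ 2 := by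
    rw [div_mul_eq_mul_div, le_div_iff₀ hγ2]; linarith
  have e2' : ∫ x, α x ^ 2 ≤ Cα * ∫ x, f x ^ 2 := by
    rw [div_mul_eq_mul_div, le_div_iff₀ hγ2]
    nlinarith [mul_le_mul_of_nonneg_left e1' hk1]
  have e4 := mul_le_mul_of_nonneg_left e2' (show 0 ≤ 2 * B ^ 2 by positivity)
  have e5 := mul_le_mul_of_nonneg_left e1' (show 0 ≤ 2 * b1 by positivity)
  calc _ ≤ _ := e3
    _ ≤ _ := add_le_add e4 e5
    _ ≤ _ := by nlinarith

def LB (W : ℝ → ℝ) : Prop := ∃ c : ℝ, 0 < c ∧ ∀ u : ℝ → ℂ, ContDiff ℝ 2 u → HasCompactSupport u →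
  c * ∫ x, ‖u x‖ ^ 2 ≤ ∫ x, ‖- deriv (deriv u) x + (W x : ℂ) * u x‖ ^ 2

lemma LB_of (W p D : ℝ → ℝ) (γ B c : ℝ) (hγ : γ ≠ 0) (hc : 0 < c)
    (hW : Continuous W) (hWb : ∀ x, |W x| ≤ B)
    (hp : ∀ x, HasDerivAt p (D x - γ * p x) x)
    (hD : ∀ x, HasDerivAt D (W x * p x - γ * D x) x)
    (hpb : ∀ x, |p x| ≤ B) (hDb : ∀ x, |D x| ≤ B)
    (hn : ∀ x, c ≤ p x ^ 2 + D x ^ 2) : LB W := by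
  obtain ⟨C, hC, h⟩ := real_bd W p D γ B c hγ hc hW hWb hp hD hpb hDb hn
  refine ⟨C⁻¹, by positivity, fun u hu hus => ?_⟩
  have hu1 : ContDiff ℝ 1 (deriv u) := (contDiff_succ_iff_deriv.1 (by rw [one_add_one_eq_two]; exact hu : ContDiff ℝ (1 + 1) u)).2.2
  have hu2 : Continuous (deriv (deriv u)) := hu1.continuous_deriv le_rfl
  have huc : Continuous u := hu.continuous
  have key : ∀ L : ℂ →L[ℝ] ℝ, deriv (deriv fun x => L (u x)) = fun x => L (deriv (deriv u) x) := by
    intro L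
    have h1 : deriv (fun x => L (u x)) = fun x => L (deriv u x) := by
      ext x
      exact (L.hasFDerivAt.comp_hasDerivAt x (hu.differentiable (by norm_num) x).hasDerivAt).deriv
    rw [h1]
    ext x
    exact (L.hasFDerivAt.comp_hasDerivAt x (hu1.differentiable (by norm_num) x).hasDerivAt).deriv
  have hh : ∀ L : ℂ →L[ℝ] ℝ, ∫ x, L (u x) ^ 2 ≤
      C * ∫ x, (L (- deriv (deriv u) x + (W x : ℂ) * u x)) ^ 2 := by
    intro L
    have := h (fun x => L (u x)) (L.contDiff.comp hu) (hus.comp_left (map_zero L))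
    rw [key L] at this
    convert this using 5 with x
    rw [map_add, map_neg, ← Complex.real_smul, map_smul, smul_eq_mul]
  have hs2 : HasCompactSupport fun x => - deriv (deriv u) x + (W x : ℂ) * u x :=
    (hus.deriv.deriv.neg).add hus.mul_left
  have hc2 : Continuous fun x => - deriv (deriv u) x + (W x : ℂ) * u x := by fun_prop
  have split : ∀ v : ℝ → ℂ, Continuous v → HasCompactSupport v →
      ∫ x, ‖v x‖ ^ 2 = (∫ x, (Complex.reCLM (v x)) ^ 2) + ∫ x, (Complex.imCLM (v x)) ^ 2 := by
    intro v hv hvs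
    rw [← integral_add]
    · congr 1; ext x
      rw [Complex.sq_norm, Complex.normSq_apply]; simp; ring
    · exact cc_int (by fun_prop) (hvs.comp_left (g := fun z => (Complex.reCLM z) ^ 2) (by simp))
    · exact cc_int (by fun_prop) (hvs.comp_left (g := fun z => (Complex.imCLM z) ^ 2) (by simp))
  rw [split u huc hus, split _ hc2 hs2, inv_mul_le_iff₀ hC]
  have := hh Complex.reCLM
  have := hh Complex.imCLM
  linarith

lemma per_bdd {f : ℝ → ℝ} {T : ℝ} (hT : 0 < T) (hf : Continuous f) (hp : Function.Periodic f T) :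
    ∃ B, ∀ x, |f x| ≤ B := by
  obtain ⟨B, hB⟩ := (isCompact_Icc (a := (0:ℝ)) (b := T)).exists_bound_of_continuousOn
    hf.continuousOn
  refine ⟨B, fun x => ?_⟩
  obtain ⟨y, hy, e⟩ := hp.exists_mem_Ico₀ hT x
  rw [e]; exact hB y ⟨hy.1, hy.2.le⟩

lemma per_pos {f : ℝ → ℝ} {T : ℝ} (hT : 0 < T) (hf : Continuous f) (hp : Function.Periodic f T)
    (h0 : ∀ x, 0 < f x) : ∃ c, 0 < c ∧ ∀ x, c ≤ f x := by
  obtain ⟨x0, -, hx0⟩ := (isCompact_Icc (a := (0:ℝ)) (b := T)).exists_isMinOn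
    ⟨0, le_rfl, hT.le⟩ hf.continuousOn
  refine ⟨f x0, h0 _, fun x => ?_⟩
  obtain ⟨y, hy, e⟩ := hp.exists_mem_Ico₀ hT x
  rw [e]; exact hx0 (show y ∈ Icc 0 T from ⟨hy.1, hy.2.le⟩)

lemma LB_floquet (W φ ψ : ℝ → ℝ) (T μ : ℝ) (hT : 0 < T) (hW : Continuous W)
    (hper : Function.Periodic W T)
    (hφ : ∀ x, HasDerivAt φ (ψ x) x) (hψ : ∀ x, HasDerivAt ψ (W x * φ x) x)
    (hφT : ∀ x, φ (x + T) = μ * φ x) (hψT : ∀ x, ψ (x + T) = μ * ψ x)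
    (hnz : ∀ x, φ x ≠ 0 ∨ ψ x ≠ 0) (h0 : μ ≠ 0) (h1 : |μ| ≠ 1) : LB W := by
  have hφc : Continuous φ := continuous_iff_continuousAt.2 fun x => (hφ x).continuousAt
  have hψc : Continuous ψ := continuous_iff_continuousAt.2 fun x => (hψ x).continuousAt
  set γ := Real.log |μ| / T with hγdef
  have hμp : 0 < |μ| := abs_pos.2 h0
  have hγ : γ ≠ 0 := by
    apply div_ne_zero _ hT.ne'
    exact Real.log_ne_zero_of_pos_of_ne_one hμp h1
  set E : ℝ → ℝ := fun x => Real.exp (-γ * x) with hE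
  have hEd : ∀ x, HasDerivAt E (-γ * E x) x := by
    intro x
    have := ((hasDerivAt_id x).const_mul (-γ)).exp
    refine this.congr_deriv ?_
    simp [hE]; ring
  have hEc : Continuous E := by fun_prop
  have hEp : ∀ x, 0 < E x := fun x => Real.exp_pos _
  have hET : ∀ x, E (x + T) = E x * |μ|⁻¹ := by
    intro x
    simp only [hE]
    have : -γ * (x + T) = -γ * x + - Real.log |μ| := by
      rw [hγdef]; field_simp; ring
    rw [this, Real.exp_add, Real.exp_neg (Real.log _), Real.exp_log hμp]
  have habs : ∀ {g : ℝ → ℝ}, (∀ x, g (x + T) = μ * g x) →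
      Function.Periodic (fun x => |E x * g x|) T := by
    intro g hg x
    simp only [hET, hg, abs_mul, abs_inv, abs_abs]
    field_simp
  obtain ⟨B1, hB1⟩ := per_bdd hT (by fun_prop) (habs hφT)
  obtain ⟨B2, hB2⟩ := per_bdd hT (by fun_prop) (habs hψT)
  obtain ⟨B3, hB3⟩ := per_bdd hT hW hper
  obtain ⟨c, hc, hcl⟩ := per_pos (f := fun x => |E x * φ x| ^ 2 + |E x * ψ x| ^ 2) hT
    (by fun_prop) (fun x => by
      have e1 := habs hφT x
      have e2 := habs hψT x
      simp only at e1 e2 ⊢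
      rw [e1, e2]) (fun x => by
      have := (hEp x).ne'
      rcases hnz x with h | h <;> positivity)
  refine LB_of W (fun x => E x * φ x) (fun x => E x * ψ x) γ (max B3 (max B1 B2)) c hγ hc hW
    (fun x => (hB3 x).trans (le_max_left _ _)) (fun x => ?_) (fun x => ?_)
    (fun x => ?_) (fun x => ?_) (fun x => ?_)
  · refine ((hEd x).mul (hφ x)).congr_deriv ?_; ring
  · refine ((hEd x).mul (hψ x)).congr_deriv ?_; ring
  · have := hB1 x; rw [abs_abs] at this
    exact this.trans ((le_max_left _ _).trans (le_max_right _ _))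
  · have := hB2 x; rw [abs_abs] at this
    exact this.trans ((le_max_right _ _).trans (le_max_right _ _))
  · have := hcl x; simpa only [sq_abs] using this

lemma trick (q φ ψ : ℝ → ℝ) (T μ : ℝ) (hT : 0 < T) (hq : Continuous q)
    (hper : Function.Periodic q T)
    (hφ : ∀ x, HasDerivAt φ (ψ x) x) (hψ : ∀ x, HasDerivAt ψ (q x * φ x) x)
    (hφT : ∀ x, φ (x + T) = μ * φ x) (hψT : ∀ x, ψ (x + T) = μ * ψ x)
    (hnz : ∀ x, φ x ≠ 0 ∨ ψ x ≠ 0) (h1 : |μ| = 1) (ε : ℝ) (hε : 0 < ε) :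
    ∃ W : ℝ → ℝ, Continuous W ∧ Function.Periodic W T ∧ (∀ x, |W x - q x| ≤ ε) ∧ LB W := by
  have hφc : Continuous φ := continuous_iff_continuousAt.2 fun x => (hφ x).continuousAt
  have hψc : Continuous ψ := continuous_iff_continuousAt.2 fun x => (hψ x).continuousAt
  have hμ2 : μ ^ 2 = 1 := by rw [← sq_abs, h1]; norm_num
  have p1 : Function.Periodic (fun x => φ x * ψ x) T := fun x => by
    simp only [hφT, hψT]; linear_combination (φ x * ψ x) * hμ2
  have p2 : Function.Periodic (fun x => φ x ^ 4) T := fun x => by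
    simp only [hφT]; linear_combination (φ x ^ 4 * (μ ^ 2 + 1)) * hμ2
  have p3 : Function.Periodic (fun x => φ x ^ 2) T := fun x => by
    simp only [hφT]; linear_combination (φ x ^ 2) * hμ2
  obtain ⟨B1, hB1⟩ := per_bdd hT (by fun_prop) p1
  obtain ⟨B2, hB2⟩ := per_bdd hT (by fun_prop) p2
  have hB1p : 0 ≤ B1 := (abs_nonneg _).trans (hB1 0)
  have hB2p : 0 ≤ B2 := (abs_nonneg _).trans (hB2 0)
  set δ := min 1 (ε / (4 * B1 + B2 + 1)) with hδ
  have hden : 0 < 4 * B1 + B2 + 1 := by positivity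
  have hδp : 0 < δ := lt_min one_pos (by positivity)
  have hδ1 : δ ≤ 1 := min_le_left _ _
  have hδ2 : δ * (4 * B1 + B2 + 1) ≤ ε := by
    rw [← le_div_iff₀ hden]; exact min_le_right _ _
  set J := ∫ x in (0:ℝ)..T, φ x ^ 2 with hJ
  have hJp : 0 < J := by
    apply intervalIntegral.integral_pos hT (by fun_prop) (fun x _ => sq_nonneg _)
    by_contra hcon
    push Not at hcon
    have hz : ∀ x ∈ Icc 0 T, φ x = 0 := fun x hx => by
      have := hcon x hx; nlinarith [sq_nonneg (φ x)]
    have hev : φ =ᶠ[nhds (T / 2)] fun _ => 0 := by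
      filter_upwards [Icc_mem_nhds (show 0 < T / 2 by linarith) (show T / 2 < T by linarith)]
        with x hx using hz x hx
    have h3 := (hφ (T / 2)).unique ((hasDerivAt_const (T / 2) (0:ℝ)).congr_of_eventuallyEq hev)
    rcases hnz (T / 2) with h | h
    · exact h (hz _ ⟨by linarith, by linarith⟩)
    · exact h h3
  set Φ : ℝ → ℝ := fun x => ∫ s in (0:ℝ)..x, φ s ^ 2 with hΦ
  have hsc : Continuous fun x => φ x ^ 2 := by fun_prop
  have hΦd : ∀ x, HasDerivAt Φ (φ x ^ 2) x := fun x =>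
    intervalIntegral.integral_hasDerivAt_right (hsc.intervalIntegrable 0 x)
      hsc.aestronglyMeasurable.stronglyMeasurableAtFilter hsc.continuousAt
  have hΦT : ∀ x, Φ (x + T) = Φ x + J := by
    intro x
    have := p3.intervalIntegral_add_eq_add 0 x (fun a b => hsc.intervalIntegrable a b)
    simpa [hΦ, hJ] using this
  have hed : ∀ x, HasDerivAt (fun x => Real.exp (δ * Φ x))
      (δ * φ x ^ 2 * Real.exp (δ * Φ x)) x := by
    intro x
    refine (((hΦd x).const_mul δ).exp).congr_deriv ?_
    ring
  have heT : ∀ x, Real.exp (δ * Φ (x + T)) = Real.exp (δ * Φ x) * Real.exp (δ * J) := by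
    intro x; rw [hΦT, ← Real.exp_add]; ring_nf
  have hWc : Continuous fun x => q x + 4 * δ * (φ x * ψ x) + δ ^ 2 * φ x ^ 4 := by fun_prop
  have hWp : Function.Periodic (fun x => q x + 4 * δ * (φ x * ψ x) + δ ^ 2 * φ x ^ 4) T := by
    intro x
    have e1 := p1 x
    have e2 := p2 x
    simp only at e1 e2 ⊢
    rw [e1, e2, hper x]
  refine ⟨_, hWc, hWp, ?_, ?_⟩
  · intro x
    have e : q x + 4 * δ * (φ x * ψ x) + δ ^ 2 * φ x ^ 4 - q x =
      4 * δ * (φ x * ψ x) + δ ^ 2 * φ x ^ 4 := by ring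
    rw [e]
    refine (abs_add_le _ _).trans ?_
    rw [abs_mul, abs_mul (δ ^ 2), abs_of_pos (show 0 < 4 * δ by positivity),
      abs_of_pos (show 0 < δ ^ 2 by positivity)]
    have a1 := mul_le_mul_of_nonneg_left (hB1 x) (show 0 ≤ 4 * δ by positivity)
    have a2 := mul_le_mul_of_nonneg_left (hB2 x) (show 0 ≤ δ ^ 2 by positivity)
    have a3 : δ ^ 2 * B2 ≤ δ * B2 := by
      apply mul_le_mul_of_nonneg_right _ hB2p; nlinarith
    nlinarith
  · refine LB_floquet _ (fun x => φ x * Real.exp (δ * Φ x))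
      (fun x => (ψ x + δ * φ x ^ 3) * Real.exp (δ * Φ x)) T (μ * Real.exp (δ * J)) hT hWc hWp
      (fun x => ?_) (fun x => ?_) (fun x => ?_) (fun x => ?_) (fun x => ?_) ?_ ?_
    · refine ((hφ x).mul (hed x)).congr_deriv ?_; ring
    · refine (((hψ x).add (((hφ x).pow 3).const_mul δ)).mul (hed x)).congr_deriv ?_
      simp; ring
    · simp only [heT, hφT]; ring
    · simp only [heT, hφT, hψT]
      linear_combination (δ * μ * φ x ^ 3 * Real.exp (δ * Φ x) * Real.exp (δ * J)) * hμ2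
    · have he := (Real.exp_pos (δ * Φ x)).ne'
      by_cases h : φ x = 0
      · right
        have := (hnz x).resolve_left (by simpa using h)
        simp [h, this]
      · left; exact mul_ne_zero h he
    · apply mul_ne_zero _ (Real.exp_pos _).ne'
      rintro rfl; simp at h1
    · rw [abs_mul, h1, one_mul, abs_of_pos (Real.exp_pos _)]
      exact (Real.one_lt_exp_iff.2 (by positivity)).ne'

lemma elliptic (q a b a' b' : ℝ → ℝ) (T c : ℝ) (hT : 0 < T) (hq : Continuous q)
    (hper : Function.Periodic q T) (hc : c ≠ 0)
    (ha : ∀ x, HasDerivAt a (a' x) x) (ha' : ∀ x, HasDerivAt a' (q x * a x) x)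
    (hb : ∀ x, HasDerivAt b (b' x) x) (hb' : ∀ x, HasDerivAt b' (q x * b x) x)
    (hwr : ∀ x, a x * b' x - a' x * b x = c)
    (hN : Function.Periodic (fun x => a x ^ 2 + b x ^ 2) T)
    (hM : Function.Periodic (fun x => a x * a' x + b x * b' x) T) (ε : ℝ) (hε : 0 < ε) :
    ∃ k : ℕ, 0 < k ∧
    ∃ W : ℝ → ℝ, Continuous W ∧ Function.Periodic W (k * T) ∧ (∀ x, |W x - q x| ≤ ε) ∧ LB W := by
  have hac : Continuous a := continuous_iff_continuousAt.2 fun x => (ha x).continuousAt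
  have hbc : Continuous b := continuous_iff_continuousAt.2 fun x => (hb x).continuousAt
  set N : ℝ → ℝ := fun x => a x ^ 2 + b x ^ 2 with hNdef
  set M : ℝ → ℝ := fun x => a x * a' x + b x * b' x with hMdef
  have hNc : Continuous N := by fun_prop
  have hNp : ∀ x, 0 < N x := by
    intro x
    by_contra h
    have h0 : a x = 0 := by simp only [hNdef] at h; nlinarith [sq_nonneg (a x), sq_nonneg (b x)]
    have h1 : b x = 0 := by simp only [hNdef] at h; nlinarith [sq_nonneg (a x), sq_nonneg (b x)]
    apply hc; rw [← hwr x, h0, h1]; ring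
  have hN0 : ∀ x, N x ≠ 0 := fun x => (hNp x).ne'
  have hNd : ∀ x, HasDerivAt N (2 * M x) x := by
    intro x
    refine (((ha x).pow 2).add ((hb x).pow 2)).congr_deriv ?_
    simp [hMdef]; ring
  have hMd : ∀ x, HasDerivAt M (q x * N x + (M x ^ 2 + c ^ 2) / N x) x := by
    intro x
    refine (((ha x).mul (ha' x)).add ((hb x).mul (hb' x))).congr_deriv ?_
    have h := hN0 x
    rw [← hwr x]
    field_simp
    simp only [hNdef, hMdef]; ring
  have hIc : Continuous fun x => (N x)⁻¹ := hNc.inv₀ hN0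
  have hIper : Function.Periodic (fun x => (N x)⁻¹) T := fun x => by simp only [hN x]
  set Φ : ℝ → ℝ := fun x => c * ∫ s in (0:ℝ)..x, (N s)⁻¹ with hΦ
  have hΦd : ∀ x, HasDerivAt Φ (c / N x) x := fun x =>
    (intervalIntegral.integral_hasDerivAt_right (hIc.intervalIntegrable 0 x)
      hIc.aestronglyMeasurable.stronglyMeasurableAtFilter hIc.continuousAt).const_mul c
  set Θ := c * ∫ s in (0:ℝ)..T, (N s)⁻¹ with hΘ
  have hΘ0 : Θ ≠ 0 := by
    apply mul_ne_zero hc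
    apply ne_of_gt
    apply intervalIntegral.intervalIntegral_pos_of_pos (hIc.intervalIntegrable _ _) _ hT
    intro x; exact inv_pos.2 (hNp x)
  have hΦT : ∀ x, Φ (x + T) = Φ x + Θ := by
    intro x
    have := hIper.intervalIntegral_add_eq_add 0 x (fun a b => hIc.intervalIntegrable a b)
    simp only [hΦ, hΘ, this, zero_add]; ring
  have hΦk : ∀ k : ℕ, ∀ x, Φ (x + k * T) = Φ x + k * Θ := by
    intro k
    induction k with
    | zero => intro x; simp
    | succ k ih =>
      intro x
      push_cast
      rw [show x + (k + 1) * T = (x + k * T) + T by ring, hΦT, ih]; ring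
  have hBper : Function.Periodic (fun x => c ^ 2 / N x ^ 2) T := fun x => by simp only [hN x]
  have hBc : Continuous fun x => c ^ 2 / N x ^ 2 :=
    continuous_const.div (by fun_prop) (fun x => pow_ne_zero _ (hN0 x))
  obtain ⟨B, hB⟩ := per_bdd hT hBc hBper
  have hBp : 0 ≤ B := (abs_nonneg _).trans (hB 0)
  set η := min (1/2) (ε / 2 / (3 * B + 1)) with hη
  have hηp : 0 < η := lt_min (by norm_num) (by positivity)
  have hη1 : η ≤ 1 / 2 := min_le_left _ _
  have hη2 : η * (3 * B + 1) ≤ ε / 2 := by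
    rw [← le_div_iff₀ (by positivity)]; exact min_le_right _ _
  obtain ⟨k0, hk0⟩ := exists_nat_gt (Real.pi / (η * |Θ|))
  set k := k0 + 1 with hk
  have hkp : 0 < k := Nat.succ_pos _
  have hkr : (0:ℝ) < k := by exact_mod_cast hkp
  have hΘa : 0 < |Θ| := abs_pos.2 hΘ0
  have hkb : Real.pi ≤ η * (k * |Θ|) := by
    have : Real.pi / (η * |Θ|) ≤ k := by rw [hk]; push_cast; linarith
    rw [div_le_iff₀ (by positivity)] at this
    linarith
  set m : ℤ := round (k * Θ / Real.pi) with hm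
  have hmb : |k * Θ - m * Real.pi| ≤ Real.pi := by
    have := abs_sub_round (k * Θ / Real.pi)
    have e : k * Θ - m * Real.pi = (k * Θ / Real.pi - m) * Real.pi := by
      field_simp
    rw [e, abs_mul, abs_of_pos Real.pi_pos]
    nlinarith [Real.pi_pos]
  set ω := m * Real.pi / (k * Θ) with hω
  have hω1 : ω * (k * Θ) = m * Real.pi := by rw [hω]; field_simp
  have hωb : |ω - 1| ≤ η := by
    have e : k * Θ - m * Real.pi = (1 - ω) * (k * Θ) := by rw [← hω1]; ring
    rw [e, abs_mul, abs_mul (k:ℝ), abs_of_pos hkr, abs_sub_comm] at hmb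
    have : |ω - 1| * (k * |Θ|) ≤ η * (k * |Θ|) := hmb.trans hkb
    exact le_of_mul_le_mul_right this (by positivity)
  have hωb' := abs_le.1 hωb
  have hω0 : ω ≠ 0 := by have := hωb'.1; intro h; rw [h] at this; linarith
  have hω2 : |1 - ω ^ 2| ≤ 3 * η := by
    have e : 1 - ω ^ 2 = (1 - ω) * (1 + ω) := by ring
    rw [e, abs_mul, abs_sub_comm, mul_comm]
    apply mul_le_mul _ hωb (abs_nonneg _) (by norm_num)
    rw [abs_le]; constructor <;> linarith
  have hper' : ∀ {f : ℝ → ℝ}, Function.Periodic f T → Function.Periodic f (k * T) :=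
    fun h => h.nat_mul k
  set W : ℝ → ℝ := fun x => q x + (1 - ω ^ 2) * (c ^ 2 / N x ^ 2) with hW
  have hWc : Continuous W := by fun_prop
  have hWp : Function.Periodic W (k * T) := by
    intro x
    have e1 := hper' hper x
    have e2 := hper' hBper x
    simp only [hW] at e1 e2 ⊢
    rw [e1, e2]
  have hWq : ∀ x, |W x - q x| ≤ ε / 2 := by
    intro x
    have e : W x - q x = (1 - ω ^ 2) * (c ^ 2 / N x ^ 2) := by simp only [hW]; ring
    rw [e, abs_mul]
    have := mul_le_mul hω2 (hB x) (abs_nonneg _) (by positivity)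
    linarith
  set ρ : ℝ → ℝ := fun x => Real.sqrt (N x) with hρ
  have hρp : ∀ x, 0 < ρ x := fun x => Real.sqrt_pos.2 (hNp x)
  have hρ2 : ∀ x, ρ x ^ 2 = N x := fun x => Real.sq_sqrt (hNp x).le
  have hρd : ∀ x, HasDerivAt ρ (M x / ρ x) x := by
    intro x
    refine ((hNd x).sqrt (hN0 x)).congr_deriv ?_
    simp only [hρ]
    field_simp
  have hcd : ∀ x, HasDerivAt (fun x => Real.cos (ω * Φ x))
      (- Real.sin (ω * Φ x) * (ω * (c / N x))) x := fun x => ((hΦd x).const_mul ω).cos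
  have hsd : ∀ x, HasDerivAt (fun x => Real.sin (ω * Φ x))
      (Real.cos (ω * Φ x) * (ω * (c / N x))) x := fun x => ((hΦd x).const_mul ω).sin
  have hNk : ∀ x, N (x + k * T) = N x := hper' hN
  have hMk : ∀ x, M (x + k * T) = M x := hper' hM
  have hρk : ∀ x, ρ (x + k * T) = ρ x := fun x => by simp only [hρ, hNk]
  have hck : ∀ x, Real.cos (ω * Φ (x + k * T)) = (-1) ^ m * Real.cos (ω * Φ x) := by
    intro x
    rw [hΦk, mul_add, hω1, Real.cos_add_int_mul_pi]
  have hsk : ∀ x, Real.sin (ω * Φ (x + k * T)) = (-1) ^ m * Real.sin (ω * Φ x) := by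
    intro x
    rw [hΦk, mul_add, hω1, Real.sin_add_int_mul_pi]
  obtain ⟨W', h1, h2, h3, h4⟩ := trick W (fun x => ρ x * Real.cos (ω * Φ x))
    (fun x => (M x * Real.cos (ω * Φ x) - ω * c * Real.sin (ω * Φ x)) / ρ x) (k * T) ((-1) ^ m)
    (by positivity) hWc hWp (fun x => by
      refine ((hρd x).mul (hcd x)).congr_deriv ?_
      have := (hρp x).ne'
      rw [← hρ2 x]
      field_simp
      ring) (fun x => by
      refine ((((hMd x).mul (hcd x)).sub ((hsd x).const_mul (ω * c))).div (hρd x)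
        (hρp x).ne').congr_deriv ?_
      have := (hρp x).ne'
      simp only [hW]
      rw [← hρ2 x]
      simp
      field_simp
      ring) (fun x => by simp only [hρk, hck]; ring)
      (fun x => by simp only [hρk, hck, hMk, hsk]; ring)
      (fun x => by
        have := (hρp x).ne'
        by_cases h : Real.cos (ω * Φ x) = 0
        · right
          have hs : Real.sin (ω * Φ x) ≠ 0 := by
            intro hs
            have := Real.sin_sq_add_cos_sq (ω * Φ x)
            rw [h, hs] at this; norm_num at this
          simp [h, hs, this, hω0, hc]
        · left; exact mul_ne_zero this h)
      (by rw [abs_zpow]; simp) (ε / 2) (by positivity)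
  refine ⟨k, hkp, W', h1, h2, fun x => ?_, h4⟩
  have := abs_add_le (W' x - W x) (W x - q x)
  rw [sub_add_sub_cancel] at this
  linarith [h3 x, hWq x]

lemma main_local (q : ℝ → ℝ) (T : ℝ) (hT : 0 < T) (hq : Continuous q)
    (hper : Function.Periodic q T) (ε : ℝ) (hε : 0 < ε) :
    ∃ k : ℕ, 0 < k ∧
    ∃ W : ℝ → ℝ, Continuous W ∧ Function.Periodic W (k * T) ∧ (∀ x, |W x - q x| ≤ ε) ∧ LB W := by
  obtain ⟨C, hC⟩ := per_bdd hT hq hper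
  obtain ⟨y1, h10, hy1⟩ := ode_exists q hq C hC (1, 0)
  obtain ⟨y2, h20, hy2⟩ := ode_exists q hq C hC (0, 1)
  have hlin : ∀ (s t : ℝ) (x : ℝ), HasDerivAt (fun x => s • y1 x + t • y2 x)
      (fld q x (s • y1 x + t • y2 x)) x := by
    intro s t x
    refine (((hy1 x).const_smul s).add ((hy2 x).const_smul t)).congr_deriv ?_
    ext <;> simp [fld]; ring
  have hshift : ∀ {y : ℝ → ℝ × ℝ}, (∀ x, HasDerivAt y (fld q x (y x)) x) →
      ∀ x, HasDerivAt (fun x => y (x + T)) (fld q x (y (x + T))) x := by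
    intro y hy x
    have := (hy (x + T)).comp_add_const x T
    refine this.congr_deriv ?_
    simp only [fld, hper x]
  have e1 : ∀ x, y1 (x + T) = (y1 T).1 • y1 x + (y1 T).2 • y2 x := by
    have := ode_unique q C hC (hshift hy1) (hlin (y1 T).1 (y1 T).2) (t0 := 0)
      (by ext <;> simp [h10, h20])
    exact fun x => congrFun this x
  have e2 : ∀ x, y2 (x + T) = (y2 T).1 • y1 x + (y2 T).2 • y2 x := by
    have := ode_unique q C hC (hshift hy2) (hlin (y2 T).1 (y2 T).2) (t0 := 0)
      (by ext <;> simp [h10, h20])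
    exact fun x => congrFun this x
  have d1 : ∀ x, HasDerivAt (fun x => (y1 x).1) (y1 x).2 x := fun x => (hy1 x).fst
  have d1' : ∀ x, HasDerivAt (fun x => (y1 x).2) (q x * (y1 x).1) x := fun x => (hy1 x).snd
  have d2 : ∀ x, HasDerivAt (fun x => (y2 x).1) (y2 x).2 x := fun x => (hy2 x).fst
  have d2' : ∀ x, HasDerivAt (fun x => (y2 x).2) (q x * (y2 x).1) x := fun x => (hy2 x).snd
  have hwr : ∀ x, (y1 x).1 * (y2 x).2 - (y1 x).2 * (y2 x).1 = 1 := by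
    have hd : ∀ x, HasDerivAt (fun x => (y1 x).1 * (y2 x).2 - (y1 x).2 * (y2 x).1) 0 x := by
      intro x
      refine (((d1 x).mul (d2' x)).sub ((d1' x).mul (d2 x))).congr_deriv ?_
      ring
    intro x
    have := is_const_of_deriv_eq_zero (fun x => (hd x).differentiableAt) (fun x => (hd x).deriv) x 0
    refine this.trans ?_
    rw [h10, h20]; simp
  have hdet := hwr T
  set A := (y1 T).1
  set B := (y1 T).2
  set F := (y2 T).1
  set G := (y2 T).2
  have e11 : ∀ x, (y1 (x + T)).1 = A * (y1 x).1 + B * (y2 x).1 := fun x => by rw [e1 x]; simp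
  have e12 : ∀ x, (y1 (x + T)).2 = A * (y1 x).2 + B * (y2 x).2 := fun x => by rw [e1 x]; simp
  have e21 : ∀ x, (y2 (x + T)).1 = F * (y1 x).1 + G * (y2 x).1 := fun x => by rw [e2 x]; simp
  have e22 : ∀ x, (y2 (x + T)).2 = F * (y1 x).2 + G * (y2 x).2 := fun x => by rw [e2 x]; simp
  rcases le_or_gt 4 ((A + G) ^ 2) with htr | htr
  · -- real eigenvalue
    set r := Real.sqrt ((A + G) ^ 2 - 4) with hr
    have hr2 : r ^ 2 = (A + G) ^ 2 - 4 := Real.sq_sqrt (by linarith)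
    set μ := (A + G + r) / 2 with hμ
    have hchar : μ ^ 2 - (A + G) * μ + 1 = 0 := by rw [hμ]; linear_combination hr2 / 4
    have hμ0 : μ ≠ 0 := by intro h; rw [h] at hchar; norm_num at hchar
    obtain ⟨s, t, hst, hs, ht⟩ : ∃ s t : ℝ, (s ≠ 0 ∨ t ≠ 0) ∧ s * A + t * F = μ * s ∧
        s * B + t * G = μ * t := by
      by_cases hF : F = 0
      · by_cases hB : B = 0
        · have : (μ - A) * (μ - G) = 0 := by
            rw [hF] at hdet; linear_combination hchar + hdet
          rcases mul_eq_zero.1 this with h | h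
          · exact ⟨1, 0, by simp, by linarith, by simp [hB]⟩
          · exact ⟨0, 1, by simp, by simp [hF], by linarith⟩
        · refine ⟨μ - G, B, Or.inr hB, ?_, by ring⟩
          linear_combination - hchar - hdet
      · refine ⟨F, μ - A, Or.inl hF, by ring, ?_⟩
        linear_combination - hchar - hdet
    have hsol := hlin s t
    have hnz : ∀ x, s * (y1 x).1 + t * (y2 x).1 ≠ 0 ∨ s * (y1 x).2 + t * (y2 x).2 ≠ 0 := by
      intro x
      by_contra hcon
      push Not at hcon
      have h1 : s = 0 := by
        linear_combination (y2 x).2 * hcon.1 - (y2 x).1 * hcon.2 - s * hwr x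
      have h2 : t = 0 := by
        linear_combination (y1 x).1 * hcon.2 - (y1 x).2 * hcon.1 - t * hwr x
      rcases hst with h | h
      · exact h h1
      · exact h h2
    have hφ : ∀ x, HasDerivAt (fun x => s * (y1 x).1 + t * (y2 x).1)
      (s * (y1 x).2 + t * (y2 x).2) x := fun x => ((d1 x).const_mul s).add ((d2 x).const_mul t)
    have hψ : ∀ x, HasDerivAt (fun x => s * (y1 x).2 + t * (y2 x).2)
      (q x * (s * (y1 x).1 + t * (y2 x).1)) x := fun x =>
        (((d1' x).const_mul s).add ((d2' x).const_mul t)).congr_deriv (by ring)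
    have hφT : ∀ x, s * (y1 (x + T)).1 + t * (y2 (x + T)).1 =
        μ * (s * (y1 x).1 + t * (y2 x).1) := by
      intro x; rw [e11, e21]; linear_combination (y1 x).1 * hs + (y2 x).1 * ht
    have hψT : ∀ x, s * (y1 (x + T)).2 + t * (y2 (x + T)).2 =
        μ * (s * (y1 x).2 + t * (y2 x).2) := by
      intro x; rw [e12, e22]; linear_combination (y1 x).2 * hs + (y2 x).2 * ht
    by_cases h1 : |μ| = 1
    · obtain ⟨W, a, b, c, d⟩ := trick q _ _ T μ hT hq hper hφ hψ hφT hψT hnz h1 ε hε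
      exact ⟨1, one_pos, W, a, by simpa using b, c, d⟩
    · exact ⟨1, one_pos, q, hq, by simpa using hper, fun x => by simp [hε.le],
        LB_floquet q _ _ T μ hT hq hper hφ hψ hφT hψT hnz hμ0 h1⟩
  · -- elliptic
    set r := Real.sqrt (1 - (A + G) ^ 2 / 4) with hr
    have hpos : 0 < 1 - (A + G) ^ 2 / 4 := by linarith
    have hr2 : r ^ 2 = 1 - (A + G) ^ 2 / 4 := Real.sq_sqrt hpos.le
    have hr0 : r ≠ 0 := (Real.sqrt_pos.2 hpos).ne'
    have hF : F ≠ 0 := by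
      intro h
      rw [h] at hdet
      nlinarith [sq_nonneg (A - G)]
    refine elliptic q (fun x => F * (y1 x).1 + (G - A) / 2 * (y2 x).1) (fun x => r * (y2 x).1)
      (fun x => F * (y1 x).2 + (G - A) / 2 * (y2 x).2) (fun x => r * (y2 x).2) T (F * r) hT hq hper
      (mul_ne_zero hF hr0)
      (fun x => ((d1 x).const_mul _).add ((d2 x).const_mul _))
      (fun x => (((d1' x).const_mul _).add ((d2' x).const_mul _)).congr_deriv (by ring))
      (fun x => (d2 x).const_mul _)
      (fun x => ((d2' x).const_mul _).congr_deriv (by ring))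
      (fun x => by linear_combination (F * r) * hwr x) (fun x => ?_) (fun x => ?_) ε hε
    · simp only [e11, e21, mul_pow, hr2]
      generalize (y1 x).1 = a
      generalize (y2 x).1 = b
      linear_combination (F * (F * a ^ 2 + (G - A) * a * b - B * b ^ 2) -
        ((F * a + G * b) ^ 2 - b ^ 2)) * hdet
    · simp only [e11, e21, e12, e22]
      generalize (y1 x).1 = a
      generalize (y2 x).1 = b
      generalize (y1 x).2 = a'
      generalize (y2 x).2 = b'
      linear_combination (F * (F * a * a' + (G - A) / 2 * (a * b' + a' * b) - B * b * b') -
        ((F * a + G * b) * (F * a' + G * b') - b * b')) * hdet +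
        ((F * a + G * b) * (F * a' + G * b') - b * b') * hr2

lemma LB_open (W : ℝ → ℝ) (hW : Continuous W) (B lam0 E0 : ℝ) (hB : ∀ x, |W x| ≤ B)
    (h : LB fun x => lam0 * W x - E0) :
    ∃ η : ℝ, 0 < η ∧ ∀ lam E : ℝ, |lam - lam0| < η → |E - E0| < η →
      E ∉ schrodingerSpectrum (fun x => lam * W x) := by
  obtain ⟨c, hc, h⟩ := h
  have hBp : 0 ≤ B := (abs_nonneg _).trans (hB 0)
  set d := min 1 (c / 4) with hd
  have hd0 : 0 < d := lt_min one_pos (by positivity)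
  have hd2 : d ^ 2 ≤ c / 4 := by
    have h1 : d ≤ 1 := min_le_left _ _
    have h2 : d ≤ c / 4 := min_le_right _ _
    nlinarith
  refine ⟨d / (B + 1), by positivity, fun lam E hl hE hmem => ?_⟩
  obtain ⟨u, hu, hus, hu1, hlt⟩ := hmem (c / 4) (by positivity)
  have hu1' : ContDiff ℝ 1 (deriv u) := (contDiff_succ_iff_deriv.1 (by rw [one_add_one_eq_two]; exact hu : ContDiff ℝ (1 + 1) u)).2.2
  have hu2 : Continuous (deriv (deriv u)) := hu1'.continuous_deriv le_rfl
  have huc : Continuous u := hu.continuous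
  have key := h u hu hus
  set f : ℝ → ℂ := fun x => - deriv (deriv u) x + ((lam0 * W x - E0 : ℝ) : ℂ) * u x with hf
  set g : ℝ → ℂ := fun x => - deriv (deriv u) x + ((lam * W x : ℝ) : ℂ) * u x - (E : ℂ) * u x with hg
  have hgc : Continuous g := by fun_prop
  have hfc : Continuous f := by fun_prop
  have hfs : HasCompactSupport f := (hus.deriv.deriv.neg).add hus.mul_left
  have hgs : HasCompactSupport g := ((hus.deriv.deriv.neg).add hus.mul_left).sub hus.mul_left
  have sqi : ∀ {v : ℝ → ℂ}, Continuous v → HasCompactSupport v → Integrable fun x => ‖v x‖ ^ 2 :=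
    fun {v} h1 h2 => cc_int (by fun_prop) (h2.comp_left (g := fun z => ‖z‖ ^ 2) (by simp))
  have hcmp : ∫ x, ‖f x‖ ^ 2 ≤ 2 * (∫ x, ‖g x‖ ^ 2) + 2 * d ^ 2 * ∫ x, ‖u x‖ ^ 2 := by
    rw [← integral_const_mul, ← integral_const_mul,
      ← integral_add ((sqi hgc hgs).const_mul _) ((sqi huc hus).const_mul _)]
    apply integral_mono (sqi hfc hfs) (((sqi hgc hgs).const_mul _).add ((sqi huc hus).const_mul _))
    intro x
    show ‖f x‖ ^ 2 ≤ 2 * ‖g x‖ ^ 2 + 2 * d ^ 2 * ‖u x‖ ^ 2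
    have e : f x = g x - (((lam - lam0) * W x - (E - E0) : ℝ) : ℂ) * u x := by
      simp only [hf, hg]; push_cast; ring
    have hb : |(lam - lam0) * W x - (E - E0)| ≤ d := by
      refine (abs_sub _ _).trans ?_
      rw [abs_mul]
      have h1 := mul_le_mul hl.le (hB x) (abs_nonneg _) (by positivity)
      have h2 : d / (B + 1) * (B + 1) = d := by field_simp
      nlinarith
    have hn : ‖f x‖ ≤ ‖g x‖ + d * ‖u x‖ := by
      rw [e]
      refine (norm_sub_le _ _).trans ?_
      rw [norm_mul, Complex.norm_real, Real.norm_eq_abs]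
      gcongr
    calc ‖f x‖ ^ 2 ≤ (‖g x‖ + d * ‖u x‖) ^ 2 := by gcongr
      _ ≤ _ := by nlinarith [sq_nonneg (‖g x‖ - d * ‖u x‖)]
  rw [hu1] at hcmp key
  have hlt' : ∫ x, ‖g x‖ ^ 2 < c / 4 := hlt
  linarith

/-- If `V` is continuous and `T`-periodic, `ε > 0`, and `Λ, R > 1`, then
there are `T' > 0` (an integer multiple of `T`) and finitely many continuous `T'`-periodic
potentials `W₁, …, W_ℓ` with `‖W_j - V‖_∞ < ε`, such that for every `λ ∈ [Λ⁻¹, Λ]` one has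
`[-R,R] ∩ ⋂_j σ(H_{λW_j}) = ∅`. -/
theorem exists_finite_family_resolvent_cover (V : ℝ → ℝ) (T : ℝ)
    (hV : Continuous V) (hT : 0 < T) (hper : Function.Periodic V T)
    (ε Λ R : ℝ) (hε : 0 < ε) (hΛ : 1 < Λ) (hR : 1 < R) :
    ∃ T' : ℝ, 0 < T' ∧ (∃ k : ℕ, T' = k * T) ∧
      ∃ (ℓ : ℕ) (W : Fin ℓ → ℝ → ℝ), 0 < ℓ ∧
        (∀ j : Fin ℓ, Continuous (W j) ∧ Function.Periodic (W j) T' ∧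
          (⨆ x : ℝ, |W j x - V x|) < ε) ∧
        ∀ lam ∈ Set.Icc Λ⁻¹ Λ,
          Set.Icc (-R) R ∩ ⋂ j : Fin ℓ, schrodingerSpectrum (fun x => lam * W j x) = ∅ := by
  have hΛ0 : 0 < Λ := by linarith
  have hloc : ∀ P : ℝ × ℝ, ∃ (k : ℕ) (W : ℝ → ℝ) (η : ℝ), P ∈ Set.Icc Λ⁻¹ Λ ×ˢ Set.Icc (-R) R →
      0 < k ∧ Continuous W ∧ Function.Periodic W (k * T) ∧ (∀ x, |W x - V x| ≤ ε / 2) ∧ 0 < η ∧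
      ∀ lam E : ℝ, |lam - P.1| < η → |E - P.2| < η →
        E ∉ schrodingerSpectrum (fun x => lam * W x) := by
    rintro ⟨l0, E0⟩
    by_cases hP : (l0, E0) ∈ Set.Icc Λ⁻¹ Λ ×ˢ Set.Icc (-R) R
    swap
    · exact ⟨0, V, 0, fun h => absurd h hP⟩
    have hl0 : 0 < l0 := lt_of_lt_of_le (inv_pos.2 hΛ0) hP.1.1
    obtain ⟨k, hk, W, hWc, hWp, hWq, hLB⟩ := main_local (fun x => l0 * V x - E0) T hT
      (by fun_prop) (fun x => by simp only [hper x]) (l0 * (ε / 2)) (by positivity)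
    have hkT : 0 < (k : ℝ) * T := by positivity
    have hW'c : Continuous fun x => (W x + E0) / l0 := by fun_prop
    have hW'p : Function.Periodic (fun x => (W x + E0) / l0) (k * T) := fun x => by
      simp only [hWp x]
    obtain ⟨B, hB⟩ := per_bdd hkT hW'c hW'p
    obtain ⟨η, hη, h⟩ := LB_open _ hW'c B l0 E0 hB (by
      have e : (fun x => l0 * ((W x + E0) / l0) - E0) = W := by
        funext x
        rw [mul_div_cancel₀ _ hl0.ne']; ring
      rw [e]; exact hLB)
    refine ⟨k, _, η, fun _ => ⟨hk, hW'c, hW'p, fun x => ?_, hη, h⟩⟩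
    have e : (W x + E0) / l0 - V x = (W x - (l0 * V x - E0)) / l0 := by field_simp; ring
    rw [e, abs_div, abs_of_pos hl0, div_le_iff₀ hl0]
    linarith [hWq x]
  choose k W η h using hloc
  have hcpt : IsCompact (Set.Icc Λ⁻¹ Λ ×ˢ Set.Icc (-R) R) := isCompact_Icc.prod isCompact_Icc
  obtain ⟨t, htK, htc⟩ := hcpt.elim_nhds_subcover (fun P => Metric.ball P (η P))
    (fun P hP => Metric.ball_mem_nhds P (h P hP).2.2.2.2.1)
  have hΛ1 : Λ⁻¹ ≤ Λ := (inv_le_one_of_one_le₀ hΛ.le).trans hΛ.le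
  have htne : t.Nonempty := by
    have : ((Λ, R) : ℝ × ℝ) ∈ Set.Icc Λ⁻¹ Λ ×ˢ Set.Icc (-R) R :=
      ⟨⟨hΛ1, le_rfl⟩, ⟨by linarith, le_rfl⟩⟩
    obtain ⟨P, hP, -⟩ := Set.mem_iUnion₂.1 (htc this)
    exact ⟨P, hP⟩
  have hkpos : ∀ P ∈ t, 0 < k P := fun P hP => (h P (htK P hP)).1
  refine ⟨(∏ P ∈ t, k P : ℕ) * T, ?_, ⟨_, rfl⟩, t.card, fun j => W (t.equivFin.symm j),
    htne.card_pos, fun j => ?_, ?_⟩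
  · have : 0 < ∏ P ∈ t, k P := Finset.prod_pos hkpos
    positivity
  · have hmem := (t.equivFin.symm j).2
    obtain ⟨-, h1, h2, h3, -⟩ := h _ (htK _ hmem)
    refine ⟨h1, ?_, ?_⟩
    · obtain ⟨m, hm⟩ := Finset.dvd_prod_of_mem k hmem
      have := h2.nat_mul m
      have e : ((∏ P ∈ t, k P : ℕ) : ℝ) * T =
          (m : ℝ) * ((k (t.equivFin.symm j : ℝ × ℝ) : ℝ) * T) := by
        rw [hm]; push_cast; ring
      rw [e]; exact this
    · exact lt_of_le_of_lt (ciSup_le h3) (by linarith)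
  · intro lam hlam
    rw [Set.eq_empty_iff_forall_notMem]
    rintro E ⟨hE, hall⟩
    have hPE : ((lam, E) : ℝ × ℝ) ∈ Set.Icc Λ⁻¹ Λ ×ˢ Set.Icc (-R) R := ⟨hlam, hE⟩
    obtain ⟨P, hP, hb⟩ := Set.mem_iUnion₂.1 (htc hPE)
    rw [Metric.mem_ball, Prod.dist_eq, max_lt_iff, Real.dist_eq, Real.dist_eq] at hb
    have h6 := (h P (htK P hP)).2.2.2.2.2 lam E hb.1 hb.2
    apply h6
    have := Set.mem_iInter.1 hall (t.equivFin ⟨P, hP⟩)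
    simpa using this
end
end

section
/- If V : ℝ → ℝ is continuous and T-periodic, then for every E ∈ ℝ the Lyapunov exponent L(E,V) = lim_{x→∞} (1/x) log‖A_E^V(x,0)‖ exists and satisfies L(E,V) = (1/T) log ρ(A_E^V(T,0)), where ρ(A) denotes the spectral radius of A. In particular, E ↦ L(E,V) is continuous. -/
open MeasureTheory Filter Set BoundedContinuousFunction
open scoped ENNReal

noncomputable section
/-- `A` is the transfer matrix `A_E^V(s,t)` of `-y'' + Vy = Ey`: it maps the Cauchy data
`(y'(t), y(t))ᵀ` of any solution to `(y'(s), y(s))ᵀ`, and has determinant one. -/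
def IsTransferMatrix (V : ℝ → ℝ) (E : ℝ) (s t : ℝ) (A : Matrix (Fin 2) (Fin 2) ℝ) : Prop :=
  A.det = 1 ∧
    ∀ y : ℝ → ℝ, ContDiff ℝ 2 y →
      (∀ x : ℝ, -deriv (deriv y) x + V x * y x = E * y x) →
      A.mulVec ![deriv y t, y t] = ![deriv y s, y s]
/-- The operator norm of a `2 × 2` real matrix, induced by the Euclidean norm on `ℝ²`. -/
def matOpNorm (A : Matrix (Fin 2) (Fin 2) ℝ) : ℝ :=
  ‖Matrix.toEuclideanCLM (𝕜 := ℝ) A‖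

/-- Membership in `SO(2,ℝ)`. -/
def IsSO2 (A : Matrix (Fin 2) (Fin 2) ℝ) : Prop :=
  A * A.transpose = 1 ∧ A.det = 1

/-- The spectral radius of a `2 × 2` real matrix: the maximal modulus of a (complex)
eigenvalue. -/
def specRad (A : Matrix (Fin 2) (Fin 2) ℝ) : ℝ :=
  sSup {r : ℝ | ∃ z : ℂ, ‖z‖ = r ∧
    ∃ v : Fin 2 → ℂ, v ≠ 0 ∧ (A.map (Complex.ofReal)).mulVec v = z • v}


def lyapField (V : ℝ → ℝ) (E s : ℝ) (p : ℝ × ℝ) : ℝ × ℝ := ((V s - E) * p.2, p.1)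

def lyapTerm (V : ℝ → ℝ) (v : ℝ × ℝ) : ℕ → ℝ → ℝ → ℝ × ℝ
  | 0 => fun _ _ => v
  | (n+1) => fun E x => ∫ s in (0:ℝ)..x, lyapField V E s (lyapTerm V v n E s)

lemma lyapTerm_cont {V : ℝ → ℝ} (hV : Continuous V) (v : ℝ × ℝ) (n : ℕ) :
    Continuous (fun q : ℝ × ℝ => lyapTerm V v n q.1 q.2) := by
  induction n with
  | zero => exact continuous_const
  | succ n ih =>
    simp only [lyapTerm]
    have h : Continuous (fun q : (ℝ × ℝ) × ℝ => lyapField V q.1.1 q.2 (lyapTerm V v n q.1.1 q.2)) := by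
      have h1 : Continuous (fun q : (ℝ × ℝ) × ℝ => lyapTerm V v n q.1.1 q.2) :=
        ih.comp (by fun_prop : Continuous (fun q : (ℝ × ℝ) × ℝ => (q.1.1, q.2)))
      unfold lyapField
      fun_prop
    exact intervalIntegral.continuous_parametric_intervalIntegral_of_continuous (a₀ := 0)
      (f := fun (q : ℝ × ℝ) s => lyapField V q.1 s (lyapTerm V v n q.1 s)) (s := fun q => q.2) h
        continuous_snd

lemma lyapField_cont {V : ℝ → ℝ} (hV : Continuous V) (v : ℝ × ℝ) (n : ℕ) (E : ℝ) :
    Continuous (fun s : ℝ => lyapField V E s (lyapTerm V v n E s)) := by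
  have h1 : Continuous (fun s : ℝ => lyapTerm V v n E s) :=
    (lyapTerm_cont hV v n).comp (by fun_prop : Continuous (fun s : ℝ => (E, s)))
  unfold lyapField
  fun_prop

lemma lyapTerm_hasDeriv {V : ℝ → ℝ} (hV : Continuous V) (v : ℝ × ℝ) (n : ℕ) (E x : ℝ) :
    HasDerivAt (lyapTerm V v (n+1) E) (lyapField V E x (lyapTerm V v n E x)) x := by
  have := lyapField_cont hV v n E
  exact intervalIntegral.integral_hasDerivAt_right (this.intervalIntegrable _ _)
    (this.stronglyMeasurableAtFilter _ _) this.continuousAt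

lemma lyapField_norm {V : ℝ → ℝ} {E s M : ℝ} (hM : |V s - E| ≤ M) (h1 : 1 ≤ M) (p : ℝ × ℝ) :
    ‖lyapField V E s p‖ ≤ M * ‖p‖ := by
  unfold lyapField
  rw [Prod.norm_def]
  apply max_le
  · simp only [norm_mul]
    exact mul_le_mul hM (norm_snd_le p) (norm_nonneg _) (by linarith)
  · have := norm_fst_le p
    have := norm_nonneg p
    simp only
    nlinarith

lemma lyapTerm_bound {V : ℝ → ℝ} (hV : Continuous V) (v : ℝ × ℝ) {E R M : ℝ} (h1 : 1 ≤ M)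
    (hM : ∀ s, |s| ≤ R → |V s - E| ≤ M) (n : ℕ) (x : ℝ) (hx : |x| ≤ R) :
    ‖lyapTerm V v n E x‖ ≤ ‖v‖ * ((M * |x|) ^ n / n.factorial) := by
  have hM0 : 0 ≤ M := by linarith
  induction n generalizing x with
  | zero => simp [lyapTerm]
  | succ n ih =>
    simp only [lyapTerm]
    have key : ∀ s, |s| ≤ R → ‖lyapField V E s (lyapTerm V v n E s)‖ ≤
        ‖v‖ * M ^ (n+1) / n.factorial * |s| ^ n := by
      intro s hs
      refine (lyapField_norm (hM s hs) h1 _).trans ?_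
      calc _ ≤ M * (‖v‖ * ((M * |s|) ^ n / n.factorial)) := by gcongr; exact ih s hs
        _ = _ := by rw [mul_pow]; ring
    have hint : ∫ s in (0:ℝ)..|x|, ‖v‖ * M ^ (n+1) / n.factorial * s ^ n =
        ‖v‖ * ((M * |x|) ^ (n+1) / (n+1).factorial) := by
      rw [intervalIntegral.integral_const_mul, integral_pow, Nat.factorial_succ, mul_pow]
      push_cast
      have : (n.factorial : ℝ) ≠ 0 := by positivity
      field_simp
      simp
    rw [← hint]
    rcases le_total 0 x with h0 | h0
    · rw [abs_of_nonneg h0] at *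
      apply intervalIntegral.norm_integral_le_of_norm_le h0
      · refine Eventually.of_forall fun s hs => ?_
        have h2 := key s (by rw [abs_of_pos hs.1]; linarith [hs.2])
        rwa [abs_of_pos hs.1] at h2
      · exact (by fun_prop : Continuous fun s : ℝ => ‖v‖ * M ^ (n+1) / n.factorial * s ^ n).intervalIntegrable _ _
    · rw [abs_of_nonpos h0] at *
      have : ∫ s in (0:ℝ)..x, lyapField V E s (lyapTerm V v n E s) =
          - ∫ s in (0:ℝ)..(-x), lyapField V E (-s) (lyapTerm V v n E (-s)) := by
        rw [intervalIntegral.integral_comp_neg (fun s => lyapField V E s (lyapTerm V v n E s)),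
          intervalIntegral.integral_symm]
        simp
      rw [this, norm_neg]
      apply intervalIntegral.norm_integral_le_of_norm_le (by linarith)
      · refine Eventually.of_forall fun s hs => ?_
        have h2 := key (-s) (by rw [abs_neg, abs_of_pos hs.1]; linarith [hs.2])
        rwa [abs_neg, abs_of_pos hs.1] at h2
      · exact (by fun_prop : Continuous fun s : ℝ => ‖v‖ * M ^ (n+1) / n.factorial * s ^ n).intervalIntegrable _ _

lemma lyap_M {V : ℝ → ℝ} (hV : Continuous V) (R K : ℝ) :
    ∃ M, 1 ≤ M ∧ ∀ E, |E| ≤ K → ∀ s, |s| ≤ R → |V s - E| ≤ M := by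
  obtain ⟨C, hC⟩ := (isCompact_Icc (a := -R) (b := R)).exists_bound_of_continuousOn hV.continuousOn
  refine ⟨max 1 (C + K), le_max_left _ _, fun E hE s hs => (le_max_right _ _).trans' ?_⟩
  have := hC s (abs_le.mp hs)
  rw [Real.norm_eq_abs] at this
  have := abs_sub (V s) E
  linarith

lemma lyap_summable (c a : ℝ) : Summable (fun n : ℕ => c * (a ^ n / n.factorial)) :=
  (Real.summable_pow_div_factorial a).mul_left c

def lyapSol (V : ℝ → ℝ) (v : ℝ × ℝ) (E x : ℝ) : ℝ × ℝ := ∑' n, lyapTerm V v n E x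

lemma lyapTerm_bound' {V : ℝ → ℝ} (hV : Continuous V) (v : ℝ × ℝ) {E R M : ℝ} (h1 : 1 ≤ M)
    (hM : ∀ s, |s| ≤ R → |V s - E| ≤ M) (n : ℕ) (x : ℝ) (hx : |x| ≤ R) :
    ‖lyapTerm V v n E x‖ ≤ ‖v‖ * ((M * R) ^ n / n.factorial) := by
  refine (lyapTerm_bound hV v h1 hM n x hx).trans ?_
  have : 0 ≤ M := by linarith
  gcongr

lemma lyapTerm_summable {V : ℝ → ℝ} (hV : Continuous V) (v : ℝ × ℝ) (E x : ℝ) :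
    Summable (fun n => lyapTerm V v n E x) := by
  obtain ⟨M, h1, hM⟩ := lyap_M hV |x| |E|
  exact Summable.of_norm_bounded (lyap_summable ‖v‖ (M * |x|))
    fun n => lyapTerm_bound' hV v h1 (hM E le_rfl) n x le_rfl

lemma lyapSol_cont {V : ℝ → ℝ} (hV : Continuous V) (v : ℝ × ℝ) (x : ℝ) :
    Continuous (fun E => lyapSol V v E x) := by
  rw [continuous_iff_continuousAt]
  intro E
  obtain ⟨M, h1, hM⟩ := lyap_M hV |x| (|E| + 1)
  have : ContinuousOn (fun E => lyapSol V v E x) (Metric.ball E 1) := by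
    refine continuousOn_tsum (fun n => ?_) (lyap_summable ‖v‖ (M * |x|)) fun n F hF =>
      lyapTerm_bound' hV v h1 (hM F ?_) n x le_rfl
    · exact ((lyapTerm_cont hV v n).comp (by fun_prop : Continuous (fun E : ℝ => (E, x)))).continuousOn
    · rw [Metric.mem_ball, Real.dist_eq] at hF
      have := abs_sub_abs_le_abs_sub F E
      linarith
  exact this.continuousAt (Metric.ball_mem_nhds _ one_pos)

lemma lyapSol_zero (V : ℝ → ℝ) (v : ℝ × ℝ) (E : ℝ) : lyapSol V v E 0 = v := by
  unfold lyapSol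
  rw [tsum_eq_single 0]
  · rfl
  · intro n hn
    obtain ⟨m, rfl⟩ := Nat.exists_eq_succ_of_ne_zero hn
    simp [lyapTerm]

lemma lyapSol_hasDeriv {V : ℝ → ℝ} (hV : Continuous V) (v : ℝ × ℝ) (E x : ℝ) :
    HasDerivAt (lyapSol V v E) (lyapField V E x (lyapSol V v E x)) x := by
  obtain ⟨M, h1, hM⟩ := lyap_M hV (|x| + 1) |E|
  have hM' := hM E le_rfl
  have hx : x ∈ Metric.ball (0:ℝ) (|x| + 1) := by simp
  have hsum0 := lyapTerm_summable hV v E x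
  have hL : HasDerivAt (fun z => ∑' n, lyapTerm V v (n+1) E z)
      (∑' n, lyapField V E x (lyapTerm V v n E x)) x := by
    refine hasDerivAt_tsum_of_isPreconnected
      (lyap_summable (M * ‖v‖) (M * (|x| + 1))) Metric.isOpen_ball
      (convex_ball (0:ℝ) (|x|+1)).isPreconnected (g := fun n z => lyapTerm V v (n+1) E z)
      (g' := fun n z => lyapField V E z (lyapTerm V v n E z))
      (fun n y _ => lyapTerm_hasDeriv hV v n E y) ?_ hx ?_ hx
    · intro n y hy
      have hy' : |y| ≤ |x| + 1 := by simpa using (mem_ball_zero_iff.mp hy).le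
      refine (lyapField_norm (hM' y hy') h1 _).trans ?_
      rw [mul_assoc]
      have := lyapTerm_bound' hV v h1 hM' n y hy'
      gcongr
    · exact (summable_nat_add_iff 1).mpr hsum0
  have e1 : lyapSol V v E = fun z => v + ∑' n, lyapTerm V v (n+1) E z := by
    funext z
    exact (lyapTerm_summable hV v E z).tsum_eq_zero_add
  have e2 : lyapField V E x (lyapSol V v E x) = ∑' n, lyapField V E x (lyapTerm V v n E x) := by
    let L : ℝ × ℝ →L[ℝ] ℝ × ℝ :=
      ((V x - E) • ContinuousLinearMap.snd ℝ ℝ ℝ).prod (ContinuousLinearMap.fst ℝ ℝ ℝ)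
    exact L.map_tsum hsum0
  rw [e2, e1]
  exact hL.const_add v

lemma lyapSol_spec {V : ℝ → ℝ} (hV : Continuous V) (v : ℝ × ℝ) (E : ℝ) :
    ∃ y : ℝ → ℝ, ContDiff ℝ 2 y ∧ (∀ x : ℝ, -deriv (deriv y) x + V x * y x = E * y x) ∧
      (∀ x, y x = (lyapSol V v E x).2) ∧ ∀ x, deriv y x = (lyapSol V v E x).1 := by
  have h := lyapSol_hasDeriv hV v E
  have hc : Continuous (lyapSol V v E) := continuous_iff_continuousAt.mpr fun x => (h x).continuousAt
  have h1 : ∀ x, HasDerivAt (fun x => (lyapSol V v E x).1) ((V x - E) * (lyapSol V v E x).2) x :=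
    fun x => (h x).fst
  have h2 : ∀ x, HasDerivAt (fun x => (lyapSol V v E x).2) ((lyapSol V v E x).1) x :=
    fun x => (h x).snd
  have d1 : deriv (fun x => (lyapSol V v E x).1) = fun x => ((V x - E) * (lyapSol V v E x).2) :=
    funext fun x => (h1 x).deriv
  have d2 : deriv (fun x => (lyapSol V v E x).2) = fun x => ((lyapSol V v E x).1) :=
    funext fun x => (h2 x).deriv
  refine ⟨fun x => (lyapSol V v E x).2, ?_, ?_, fun _ => rfl, fun x => congrFun d2 x⟩
  · rw [show (2 : WithTop ℕ∞) = 1 + 1 by norm_num, contDiff_succ_iff_deriv]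
    refine ⟨fun x => (h2 x).differentiableAt, by simp, ?_⟩
    rw [d2, contDiff_one_iff_deriv, d1]
    exact ⟨fun x => (h1 x).differentiableAt, by fun_prop⟩
  · intro x
    rw [d2, d1]
    ring

def lyapRho (τ : ℝ) : ℝ := (max |τ| 2 + Real.sqrt ((max |τ| 2) ^ 2 - 4)) / 2

lemma lyapRho_cont : Continuous lyapRho := by unfold lyapRho; fun_prop

lemma lyapRho_one_le (τ : ℝ) : 1 ≤ lyapRho τ := by
  unfold lyapRho
  have := le_max_right |τ| 2
  have := Real.sqrt_nonneg ((max |τ| 2) ^ 2 - 4)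
  linarith

lemma lyap_root_le (τ : ℝ) (z : ℂ) (hz : z ^ 2 - τ * z + 1 = 0) : ‖z‖ ≤ lyapRho τ := by
  have hre := congrArg Complex.re hz
  have him := congrArg Complex.im hz
  simp [pow_two] at hre him
  have h1 := lyapRho_one_le τ
  by_cases hy : z.im = 0
  · rw [hy] at hre
    have hz' : ‖z‖ = |z.re| := by
      rw [← Complex.re_add_im z, hy]; simp
    rw [hz']
    have hτ : |τ| * |z.re| = |z.re| ^ 2 + 1 := by
      rw [← abs_mul, sq_abs, show τ * z.re = z.re ^ 2 + 1 by linarith, abs_of_pos (by positivity)]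
    have h0 := abs_nonneg z.re
    have h2 : 2 ≤ |τ| := by
      by_contra! h
      nlinarith [sq_nonneg (|z.re| - 1), abs_nonneg τ]
    unfold lyapRho
    rw [max_eq_left h2]
    have : 2 * |z.re| - |τ| ≤ Real.sqrt (|τ| ^ 2 - 4) := by
      apply Real.le_sqrt_of_sq_le
      nlinarith
    linarith
  · have h2 : τ = 2 * z.re := by
      have : z.im * (2 * z.re - τ) = 0 := by linarith
      rcases mul_eq_zero.mp this with h | h
      · exact absurd h hy
      · linarith
    have : ‖z‖ ^ 2 = 1 := by
      rw [Complex.sq_norm, Complex.normSq_apply]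
      subst h2
      linarith
    nlinarith [norm_nonneg z]

lemma lyap_root_exists (τ : ℝ) : ∃ z : ℂ, z ^ 2 - τ * z + 1 = 0 ∧ ‖z‖ = lyapRho τ := by
  rcases le_total 2 |τ| with h | h
  · have h4 : 0 ≤ |τ| ^ 2 - 4 := by nlinarith
    have hs := Real.sq_sqrt h4
    have hr : lyapRho τ ^ 2 - |τ| * lyapRho τ + 1 = 0 := by
      unfold lyapRho
      rw [max_eq_left h]
      nlinarith
    have h1 := lyapRho_one_le τ
    rcases abs_cases τ with ⟨h5, _⟩ | ⟨h5, _⟩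
    · refine ⟨(lyapRho τ : ℝ), ?_, by simp; linarith⟩
      rw [h5] at hr
      exact_mod_cast hr
    · refine ⟨((-lyapRho τ : ℝ) : ℂ), ?_, by simp; linarith⟩
      rw [h5] at hr
      have : (-lyapRho τ) ^ 2 - τ * (-lyapRho τ) + 1 = 0 := by linarith
      exact_mod_cast this
  · have h4 : 0 ≤ 4 - τ ^ 2 := by
      rw [← sq_abs]; nlinarith [abs_nonneg τ]
    have hs := Real.sq_sqrt h4
    have hr : lyapRho τ = 1 := by
      unfold lyapRho
      rw [max_eq_right h]; norm_num
    refine ⟨⟨τ / 2, Real.sqrt (4 - τ ^ 2) / 2⟩, ?_, ?_⟩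
    · apply Complex.ext
      · rw [pow_two] at hs
        simp only [pow_two, Complex.sub_re, Complex.add_re, Complex.mul_re, Complex.ofReal_re,
          Complex.ofReal_im, Complex.one_re, Complex.zero_re] at hs ⊢
        nlinarith
      · simp [pow_two]; ring
    · rw [hr]
      have : ‖(⟨τ / 2, Real.sqrt (4 - τ ^ 2) / 2⟩ : ℂ)‖ ^ 2 = 1 := by
        rw [Complex.sq_norm, Complex.normSq_apply]
        simp only; nlinarith
      exact (pow_eq_one_iff_of_nonneg (norm_nonneg _) two_ne_zero).mp this

lemma lyap_det (A : Matrix (Fin 2) (Fin 2) ℝ) (hA : A.det = 1) (z : ℂ) :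
    (algebraMap ℂ (Matrix (Fin 2) (Fin 2) ℂ) z - A.map Complex.ofReal).det
      = z ^ 2 - (A.trace : ℝ) * z + 1 := by
  rw [Matrix.det_fin_two] at hA
  have hA' : (A 0 0 : ℂ) * A 1 1 - A 0 1 * A 1 0 = 1 := by exact_mod_cast hA
  rw [← hA', Matrix.det_fin_two, Matrix.trace_fin_two]
  simp [Matrix.algebraMap_matrix_apply]
  ring

lemma lyap_eig (A : Matrix (Fin 2) (Fin 2) ℝ) (hA : A.det = 1) (z : ℂ) :
    (∃ v : Fin 2 → ℂ, v ≠ 0 ∧ (A.map (Complex.ofReal)).mulVec v = z • v) ↔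
      z ^ 2 - (A.trace : ℝ) * z + 1 = 0 := by
  rw [← lyap_det A hA, ← Matrix.exists_mulVec_eq_zero_iff]
  refine exists_congr fun v => and_congr_right fun _ => ?_
  rw [Matrix.sub_mulVec, sub_eq_zero, Algebra.algebraMap_eq_smul_one, Matrix.smul_mulVec,
    Matrix.one_mulVec]
  exact eq_comm

lemma lyap_specRad (A : Matrix (Fin 2) (Fin 2) ℝ) (hA : A.det = 1) :
    specRad A = lyapRho A.trace := by
  unfold specRad
  simp only [lyap_eig A hA]
  apply IsGreatest.csSup_eq
  constructor
  · obtain ⟨z, h1, h2⟩ := lyap_root_exists A.trace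
    exact ⟨z, h2, h1⟩
  · rintro r ⟨z, rfl, h⟩
    exact lyap_root_le _ z h

lemma lyap_mem_spec (A : Matrix (Fin 2) (Fin 2) ℝ) (hA : A.det = 1) (z : ℂ) :
    z ∈ spectrum ℂ (A.map Complex.ofReal) ↔ z ^ 2 - (A.trace : ℝ) * z + 1 = 0 := by
  rw [spectrum.mem_iff, Matrix.isUnit_iff_isUnit_det, lyap_det A hA, isUnit_iff_ne_zero, not_not]

section
open scoped Matrix.Norms.Operator

lemma lyap_spectralRadius (A : Matrix (Fin 2) (Fin 2) ℝ) (hA : A.det = 1) :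
    spectralRadius ℂ (A.map Complex.ofReal) = ENNReal.ofReal (lyapRho A.trace) := by
  have h1 := lyapRho_one_le A.trace
  apply le_antisymm
  · apply iSup₂_le
    intro z hz
    rw [lyap_mem_spec A hA] at hz
    rw [← ENNReal.ofReal_coe_nnreal, coe_nnnorm]
    exact ENNReal.ofReal_le_ofReal (lyap_root_le _ z hz)
  · obtain ⟨z, h1, h2⟩ := lyap_root_exists A.trace
    rw [← h2, ← coe_nnnorm, ENNReal.ofReal_coe_nnreal]
    exact le_iSup₂ (f := fun z (_ : z ∈ spectrum ℂ (A.map Complex.ofReal)) => (‖z‖₊ : ℝ≥0∞)) z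
      ((lyap_mem_spec A hA z).mpr h1)

lemma lyap_norm_map (A : Matrix (Fin 2) (Fin 2) ℝ) : ‖A.map Complex.ofReal‖ = ‖A‖ := by
  simp [Matrix.linfty_opNorm_def]

lemma lyap_gelfand (A : Matrix (Fin 2) (Fin 2) ℝ) (hA : A.det = 1) :
    Tendsto (fun n : ℕ => Real.log ‖A ^ n‖ / n) atTop (nhds (Real.log (specRad A))) := by
  have h := spectrum.pow_norm_pow_one_div_tendsto_nhds_spectralRadius (A.map Complex.ofReal)
  rw [lyap_spectralRadius A hA, ← lyap_specRad A hA] at h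
  have h1 := lyapRho_one_le A.trace
  rw [← lyap_specRad A hA] at h1
  have h2 := (ENNReal.tendsto_toReal ENNReal.ofReal_ne_top).comp h
  rw [ENNReal.toReal_ofReal (by linarith)] at h2
  have h3 := h2.log (by linarith)
  refine h3.congr fun n => ?_
  have e : (A.map Complex.ofReal) ^ n = (A ^ n).map Complex.ofReal :=
    (map_pow (Complex.ofRealHom.mapMatrix (m := Fin 2)) A n).symm
  have hpos : 0 < ‖A ^ n‖ := by
    rw [norm_pos_iff]
    intro h0
    have : (A ^ n).det = 1 := by rw [Matrix.det_pow, hA, one_pow]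
    rw [h0] at this
    simp at this
  simp only [Function.comp]
  rw [e, lyap_norm_map, ENNReal.toReal_ofReal (by positivity), Real.log_rpow hpos]
  ring

lemma lyap_lin_bound {F G : Type*} [NormedAddCommGroup F] [NormedSpace ℝ F] [FiniteDimensional ℝ F]
    [NormedAddCommGroup G] [NormedSpace ℝ G] (e : F →ₗ[ℝ] G) : ∃ C : ℝ, ∀ x, ‖e x‖ ≤ C * ‖x‖ :=
  ⟨‖LinearMap.toContinuousLinearMap e‖, fun x => (LinearMap.toContinuousLinearMap e).le_opNorm x⟩

lemma lyap_compare : ∃ C : ℝ, 1 ≤ C ∧ ∀ B : Matrix (Fin 2) (Fin 2) ℝ,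
    matOpNorm B ≤ C * ‖B‖ ∧ ‖B‖ ≤ C * matOpNorm B := by
  let e : Matrix (Fin 2) (Fin 2) ℝ ≃ₗ[ℝ] (EuclideanSpace ℝ (Fin 2) →L[ℝ] EuclideanSpace ℝ (Fin 2)) :=
    (Matrix.toEuclideanCLM (n := Fin 2) (𝕜 := ℝ)).toAlgEquiv.toLinearEquiv
  obtain ⟨C1, h1⟩ := lyap_lin_bound e.toLinearMap
  obtain ⟨C2, h2⟩ := lyap_lin_bound e.symm.toLinearMap
  refine ⟨max 1 (max C1 C2), le_max_left _ _, fun B => ⟨?_, ?_⟩⟩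
  · refine le_trans (h1 B) ?_
    gcongr
    exact (le_max_left _ _).trans (le_max_right _ _)
  · have h3 : ‖B‖ ≤ C2 * matOpNorm B := by
      have := h2 (e B)
      have e1 : e.symm.toLinearMap (e B) = B := e.symm_apply_apply B
      rw [e1] at this
      exact this
    have : 0 ≤ matOpNorm B := norm_nonneg _
    refine le_trans h3 ?_
    gcongr
    exact (le_max_right _ _).trans (le_max_right _ _)

lemma lyap_norm_le {B : Matrix (Fin 2) (Fin 2) ℝ} {c : ℝ} (h : ∀ i j, |B i j| ≤ c) :
    ‖B‖ ≤ 2 * c := by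
  have hc : 0 ≤ c := (abs_nonneg _).trans (h 0 0)
  lift c to NNReal using hc
  rw [Matrix.linfty_opNorm_def, show (2 * (c : ℝ)) = ((2 * c : NNReal) : ℝ) by simp,
    NNReal.coe_le_coe]
  apply Finset.sup_le
  intro i _
  rw [Fin.sum_univ_two, two_mul]
  exact add_le_add (h i 0) (h i 1)

/-- log of the norm changes boundedly under multiplication by bounded SL2 matrices. -/
lemma lyap_log_bound (c : ℝ) : ∃ K : ℝ, ∀ P Q : Matrix (Fin 2) (Fin 2) ℝ,
    P.det = 1 → Q.det = 1 → (∀ i j, |P i j| ≤ c) →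
      |Real.log (matOpNorm (P * Q)) - Real.log ‖Q‖| ≤ K := by
  obtain ⟨C, hC1, hC⟩ := lyap_compare
  refine ⟨Real.log (C * (2 * c)), fun P Q hP hQ hPc => ?_⟩
  have hpos : ∀ R : Matrix (Fin 2) (Fin 2) ℝ, R.det = 1 → 0 < ‖R‖ := by
    intro R hR
    rw [norm_pos_iff]
    rintro rfl
    simp at hR
  have hPn := lyap_norm_le hPc
  have hAn : ‖P.adjugate‖ ≤ 2 * c := by
    apply lyap_norm_le
    rw [Matrix.adjugate_fin_two]
    intro i j
    fin_cases i <;> fin_cases j <;> simp [hPc]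
  have hc : 0 < 2 * c := (hpos P hP).trans_le hPn
  have hPQ := hpos (P * Q) (by rw [Matrix.det_mul, hP, hQ, one_mul])
  have hQ0 := hpos Q hQ
  have hm : 0 < matOpNorm (P * Q) := by
    have := (hC (P * Q)).2
    by_contra! h
    nlinarith
  have u : matOpNorm (P * Q) ≤ C * (2 * c) * ‖Q‖ := by
    refine (hC _).1.trans ?_
    have := norm_mul_le P Q
    rw [mul_assoc]
    gcongr
    exact this.trans (by gcongr)
  have l : ‖Q‖ ≤ C * (2 * c) * matOpNorm (P * Q) := by
    have e : Q = P.adjugate * (P * Q) := by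
      rw [← mul_assoc, Matrix.adjugate_mul, hP, one_smul, one_mul]
    calc ‖Q‖ = ‖P.adjugate * (P * Q)‖ := by rw [← e]
      _ ≤ ‖P.adjugate‖ * ‖P * Q‖ := norm_mul_le _ _
      _ ≤ (2 * c) * (C * matOpNorm (P * Q)) := by
          gcongr
          exact (hC _).2
      _ = _ := by ring
  have hCc : 0 < C * (2 * c) := by positivity
  rw [abs_le]
  have lu := Real.log_le_log hm u
  have ll := Real.log_le_log hQ0 l
  rw [Real.log_mul hCc.ne' hQ0.ne'] at lu
  rw [Real.log_mul hCc.ne' hm.ne'] at ll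
  constructor <;> linarith

end

lemma lyap_limit {f : ℝ → ℝ} {g : ℕ → ℝ} {l T K : ℝ} (hT : 0 < T)
    (hg : Tendsto (fun n : ℕ => g n / n) atTop (nhds l))
    (hfg : ∀ x, 0 ≤ x → |f x - g ⌊x / T⌋₊| ≤ K) :
    Tendsto (fun x => (1 / x) * f x) atTop (nhds ((1 / T) * l)) := by
  have hxT : Tendsto (fun x : ℝ => x / T) atTop atTop := tendsto_id.atTop_div_const hT
  have hn : Tendsto (fun x : ℝ => ⌊x / T⌋₊) atTop atTop := tendsto_nat_floor_atTop.comp hxT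
  have h1 : Tendsto (fun x : ℝ => (⌊x / T⌋₊ : ℝ) / x) atTop (nhds (1 / T)) := by
    have := ((tendsto_nat_floor_div_atTop (R := ℝ)).comp hxT).mul_const (1 / T)
    rw [one_mul] at this
    refine this.congr' ?_
    filter_upwards [eventually_gt_atTop 0] with x hx
    simp only [Function.comp]
    field_simp
  have h2 : Tendsto (fun x : ℝ => (1 / x) * (f x - g ⌊x / T⌋₊)) atTop (nhds 0) := by
    have h3 : Tendsto (fun x : ℝ => K / x) atTop (nhds 0) := tendsto_const_nhds.div_atTop tendsto_id
    refine squeeze_zero_norm' ?_ h3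
    filter_upwards [eventually_gt_atTop 0] with x hx
    rw [norm_mul, Real.norm_eq_abs, Real.norm_eq_abs, abs_of_pos (one_div_pos.mpr hx), one_div,
      inv_mul_eq_div]
    exact div_le_div_of_nonneg_right (hfg x hx.le) hx.le
  have h4 := h2.add (h1.mul (hg.comp hn))
  rw [zero_add] at h4
  refine h4.congr' ?_
  filter_upwards [eventually_gt_atTop 0, hn.eventually_gt_atTop 0] with x hx hx2
  simp only [Function.comp]
  have : ((⌊x / T⌋₊ : ℕ) : ℝ) ≠ 0 := by positivity
  field_simp
  ring

lemma lyap_A_eq {V : ℝ → ℝ} (hV : Continuous V) {E x : ℝ} {B : Matrix (Fin 2) (Fin 2) ℝ}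
    (hB : IsTransferMatrix V E x 0 B) :
    B = !![(lyapSol V (1, 0) E x).1, (lyapSol V (0, 1) E x).1;
      (lyapSol V (1, 0) E x).2, (lyapSol V (0, 1) E x).2] := by
  obtain ⟨y, h1, h2, h3, h4⟩ := lyapSol_spec hV (1, 0) E
  obtain ⟨z, k1, k2, k3, k4⟩ := lyapSol_spec hV (0, 1) E
  have hy := hB.2 y h1 h2
  have hz := hB.2 z k1 k2
  rw [h3, h4, h3, h4, lyapSol_zero] at hy
  rw [k3, k4, k3, k4, lyapSol_zero] at hz
  have y0 := congrFun hy 0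
  have y1 := congrFun hy 1
  have z0 := congrFun hz 0
  have z1 := congrFun hz 1
  simp [Matrix.mulVec, dotProduct, Fin.sum_univ_two] at y0 y1 z0 z1
  ext i j
  fin_cases i <;> fin_cases j <;> simp [*]

lemma lyap_cocycle {V : ℝ → ℝ} (hV : Continuous V) {T E x : ℝ} (hper : Function.Periodic V T)
    {P Q R : Matrix (Fin 2) (Fin 2) ℝ} (hP : IsTransferMatrix V E x 0 P)
    (hQ : IsTransferMatrix V E T 0 Q) (hR : IsTransferMatrix V E (x + T) 0 R) : R = P * Q := by
  have key : ∀ v : ℝ × ℝ, R.mulVec ![v.1, v.2] = (P * Q).mulVec ![v.1, v.2] := by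
    intro v
    obtain ⟨y, h1, h2, h3, h4⟩ := lyapSol_spec hV v E
    have hr := hR.2 y h1 h2
    have hq := hQ.2 y h1 h2
    have d1 : deriv (fun t => y (t + T)) = fun t => deriv y (t + T) :=
      funext fun t => deriv_comp_add_const y T t
    have hp := hP.2 (fun t => y (t + T)) (h1.comp (by fun_prop)) (by
      intro t
      rw [d1, deriv_comp_add_const (deriv y) T t]
      have := h2 (t + T)
      rwa [hper t] at this)
    rw [d1] at hp
    simp only [zero_add] at hp
    have e : ![deriv y 0, y 0] = ![v.1, v.2] := by rw [h3, h4, lyapSol_zero]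
    rw [← e, hr, ← Matrix.mulVec_mulVec, hq, hp]
  have k0 := key (1, 0)
  have k1 := key (0, 1)
  ext i j
  fin_cases j
  · have := congrFun k0 i
    simpa [Matrix.mulVec, dotProduct, Fin.sum_univ_two] using this
  · have := congrFun k1 i
    simpa [Matrix.mulVec, dotProduct, Fin.sum_univ_two] using this

/-- If `V` is continuous and `T`-periodic, then for every `E ∈ ℝ` the
Lyapunov exponent `L(E,V) = lim_{x → ∞} (1/x) log ‖A_E^V(x,0)‖` exists and equals
`(1/T) log ρ(A_E^V(T,0))`; in particular `E ↦ L(E,V)` is continuous. -/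
theorem lyapunov_exponent_periodic (V : ℝ → ℝ) (T : ℝ)
    (hV : Continuous V) (hT : 0 < T) (hper : Function.Periodic V T)
    (A : ℝ → ℝ → Matrix (Fin 2) (Fin 2) ℝ)
    (hA : ∀ (E x : ℝ), IsTransferMatrix V E x 0 (A E x)) :
    (∀ E : ℝ,
      Tendsto (fun x : ℝ => (1 / x) * Real.log (matOpNorm (A E x))) atTop
        (nhds ((1 / T) * Real.log (specRad (A E T))))) ∧
    Continuous (fun E : ℝ => (1 / T) * Real.log (specRad (A E T))) := by
  have hcoc : ∀ E x (n : ℕ), A E (x + n * T) = A E x * A E T ^ n := by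
    intro E x n
    induction n with
    | zero => simp
    | succ n ih =>
      have e : x + ((n + 1 : ℕ) : ℝ) * T = (x + n * T) + T := by push_cast; ring
      rw [e, lyap_cocycle hV hper (hA E (x + n * T)) (hA E T) (hA E _), ih, pow_succ, mul_assoc]
  constructor
  · intro E
    have hent : ∀ i j, Continuous (fun x => A E x i j) := by
      have hc : ∀ v, Continuous (lyapSol V v E) := fun v =>
        continuous_iff_continuousAt.mpr fun x => (lyapSol_hasDeriv hV v E x).continuousAt
      have h1 := hc (1, 0)
      have h2 := hc (0, 1)
      intro i j
      simp_rw [fun x => lyap_A_eq hV (hA E x)]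
      fin_cases i <;> fin_cases j <;> simp <;> fun_prop
    have hb : ∀ i j, ∃ C, ∀ x ∈ Icc 0 T, ‖A E x i j‖ ≤ C := fun i j =>
      isCompact_Icc.exists_bound_of_continuousOn (hent i j).continuousOn
    choose C hC using hb
    obtain ⟨K, hK⟩ := lyap_log_bound (∑ i, ∑ j, |C i j|)
    refine lyap_limit (K := K) hT (lyap_gelfand (A E T) (hA E T).1) fun x hx => ?_
    set n := ⌊x / T⌋₊ with hn
    have n1 : (n : ℝ) * T ≤ x := (le_div_iff₀ hT).mp (Nat.floor_le (by positivity))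
    have n2 : x < ((n : ℝ) + 1) * T := (div_lt_iff₀ hT).mp (Nat.lt_floor_add_one _)
    have e : A E x = A E (x - n * T) * A E T ^ n := by rw [← hcoc]; congr 1; ring
    rw [e]
    refine hK _ _ (hA _ _).1 (by rw [Matrix.det_pow, (hA _ _).1, one_pow]) fun i j => ?_
    refine (hC i j (x - n * T) ⟨by linarith, by linarith⟩).trans ((le_abs_self _).trans ?_)
    calc |C i j| ≤ ∑ j, |C i j| :=
          Finset.single_le_sum (f := fun j => |C i j|) (fun _ _ => abs_nonneg _) (Finset.mem_univ j)
      _ ≤ _ := Finset.single_le_sum (f := fun i => ∑ j, |C i j|)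
          (fun _ _ => Finset.sum_nonneg fun _ _ => abs_nonneg _) (Finset.mem_univ i)
  · have htr : Continuous (fun E => (A E T).trace) := by
      have h1 := lyapSol_cont hV (1, 0) T
      have h2 := lyapSol_cont hV (0, 1) T
      simp_rw [fun E => lyap_A_eq hV (hA E T), Matrix.trace_fin_two]
      simp
      fun_prop
    simp_rw [fun E => lyap_specRad (A E T) (hA E T).1]
    exact continuous_const.mul ((lyapRho_cont.comp htr).log fun E =>
      (zero_lt_one.trans_le (lyapRho_one_le _)).ne')
end
end
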